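/- arXiv:math/0403544 — 2 statements merged into one kernel-verified Lean document; each statement's English description precedes it below -/
import Mathlib

section
/- Let n ≥ 2 be an integer and let φ, ψ : ℝ → ℝ be C^∞ functions with φ(0) = ψ(0) ≠ 0. Then there exist ε > 0 and a function w : ℝ → ℝ which is C^∞ on the interval [0, ε), such that w(0) = 0, w'(0) = 0, (w'(t))² = (1/(n−1))·[(n−2)·φ(t)·(w(t)² − 2·w(t)) + t²·φ(t)·ψ(t)] for all t ∈ [0, ε), and w'(t)·φ(0) > 0 for all t ∈ (0, ε). -/
open Set Filter Topology
open scoped ContDiff unitInterval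

/-- A smooth family of equations `G (t, x) = 0` whose linearization in `x` at `(0, x₀)` is invertible
has a unique solution near `x₀` for small `t`, and it depends smoothly on `t`. -/
theorem exists_smooth_implicit_curve {E : Type*} [NormedAddCommGroup E] [NormedSpace ℝ E]
    [CompleteSpace E] {G : ℝ × E → E} (hG : ContDiff ℝ ∞ G) {x₀ : E} (h₀ : G (0, x₀) = 0)
    {B : E ≃L[ℝ] E} (hB : HasFDerivAt (fun x => G (0, x)) (B : E →L[ℝ] E) x₀) :
    ∃ δ > 0, ∃ ε > 0, ∃ X : ℝ → E, ContDiffOn ℝ ∞ X (Metric.ball 0 ε) ∧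
      ∀ t ∈ Metric.ball (0 : ℝ) ε, X t ∈ Metric.ball x₀ δ ∧ G (t, X t) = 0 ∧
        ∀ x ∈ Metric.ball x₀ δ, G (t, x) = 0 → x = X t := by
  set f : ℝ × E → ℝ × E := fun p => (p.1, G p) with hf
  have hfc : ContDiff ℝ ∞ f := contDiff_fst.prodMk hG
  have hGd : HasFDerivAt G (fderiv ℝ G (0, x₀)) (0, x₀) :=
    (hG.differentiable (by simp)).differentiableAt.hasFDerivAt
  have hGB : ∀ h, fderiv ℝ G (0, x₀) (0, h) = B h := by
    have h1 : HasFDerivAt (fun x => G (0, x))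
        ((fderiv ℝ G (0, x₀)).comp (ContinuousLinearMap.inr ℝ ℝ E)) x₀ :=
      HasFDerivAt.comp (f := fun x : E => ((0 : ℝ), x)) x₀ hGd (hasFDerivAt_prodMk_right 0 x₀)
    intro h
    simpa using DFunLike.congr_fun (h1.unique hB) h
  have hsplit : ∀ p : ℝ × E, fderiv ℝ G (0, x₀) p = fderiv ℝ G (0, x₀) (p.1, 0) + B p.2 := by
    intro p
    rw [← hGB, ← map_add]
    simp
  let L : (ℝ × E) ≃L[ℝ] (ℝ × E) := ContinuousLinearEquiv.equivOfInverse
    ((ContinuousLinearMap.fst ℝ ℝ E).prod (fderiv ℝ G (0, x₀)))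
    ((ContinuousLinearMap.fst ℝ ℝ E).prod ((B.symm : E →L[ℝ] E).comp
      (ContinuousLinearMap.snd ℝ ℝ E - (fderiv ℝ G (0, x₀)).comp
        ((ContinuousLinearMap.inl ℝ ℝ E).comp (ContinuousLinearMap.fst ℝ ℝ E)))))
    (by
      intro p
      ext1
      · simp
      · simp [hsplit p])
    (by
      intro p
      ext1
      · simp
      · simp only [ContinuousLinearMap.prod_apply]
        rw [hsplit]
        simp)
  have hfL : HasStrictFDerivAt f (L : (ℝ × E) →L[ℝ] (ℝ × E)) (0, x₀) :=
    hasStrictFDerivAt_fst.prodMk (hG.contDiffAt.hasStrictFDerivAt (by simp))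
  set e := hfL.toOpenPartialHomeomorph f
  have hef : (e : ℝ × E → ℝ × E) = f := hfL.toOpenPartialHomeomorph_coe
  have hsrc : e.source ∈ 𝓝 ((0 : ℝ), x₀) :=
    e.open_source.mem_nhds hfL.mem_toOpenPartialHomeomorph_source
  have hf0 : f (0, x₀) = (0, 0) := by simp [hf, h₀]
  have htgt : ((0 : ℝ), (0 : E)) ∈ e.target := by
    rw [← hf0]; exact hfL.image_mem_toOpenPartialHomeomorph_target
  have hsymm0 : e.symm (0, 0) = (0, x₀) := by
    rw [← hf0, ← hef]
    exact e.left_inv hfL.mem_toOpenPartialHomeomorph_source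
  have hinv : ∀ᶠ p in 𝓝 ((0 : ℝ), x₀),
      fderiv ℝ f p ∈ range ((↑) : ((ℝ × E) ≃L[ℝ] (ℝ × E)) → (ℝ × E) →L[ℝ] (ℝ × E)) := by
    have h1 := (hfc.continuous_fderiv (by simp)).tendsto ((0 : ℝ), x₀)
    rw [hfL.hasFDerivAt.fderiv] at h1
    exact h1 (ContinuousLinearEquiv.nhds L)
  obtain ⟨δ, hδ, hball⟩ := Metric.mem_nhds_iff.1 (inter_mem hsrc hinv)
  have hcont : Tendsto (fun t : ℝ => e.symm (t, (0 : E))) (𝓝 0) (𝓝 (0, x₀)) := by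
    have h1 := e.continuousAt_symm htgt
    have h2 : ContinuousAt (fun t : ℝ => (t, (0 : E))) 0 := by fun_prop
    have h3 := ContinuousAt.comp (g := e.symm) (f := fun t : ℝ => (t, (0 : E))) h1 h2
    simpa [ContinuousAt, hsymm0, Function.comp_def] using h3
  have htgt' : ∀ᶠ t : ℝ in 𝓝 0, (t, (0 : E)) ∈ e.target :=
    (Continuous.continuousAt (by fun_prop : Continuous fun t : ℝ => (t, (0 : E)))).eventually_mem
      (e.open_target.mem_nhds htgt)
  obtain ⟨ε, hε, hεb⟩ := Metric.mem_nhds_iff.1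
    (inter_mem (inter_mem (hcont (Metric.ball_mem_nhds _ hδ)) htgt')
      (Metric.ball_mem_nhds (0 : ℝ) hδ))
  have hfst : ∀ t ∈ Metric.ball (0 : ℝ) ε,
      (e.symm (t, 0)).1 = t ∧ G (e.symm (t, 0)) = 0 := by
    intro t ht
    have h1 := e.right_inv (hεb ht).1.2
    rw [hef] at h1
    exact ⟨congrArg Prod.fst h1, congrArg Prod.snd h1⟩
  refine ⟨δ, hδ, ε, hε, fun t => (e.symm (t, 0)).2, ?_, ?_⟩
  · intro t ht
    apply ContDiffAt.contDiffWithinAt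
    obtain ⟨B', hB'⟩ := (hball (hεb ht).1.1).2
    have h1 : ContDiffAt ℝ ∞ e.symm (t, 0) := by
      refine e.contDiffAt_symm (f₀' := B') (hεb ht).1.2 ?_ ?_
      · rw [hB', hef]
        exact (hfc.differentiable (by simp)).differentiableAt.hasFDerivAt
      · rw [hef]; exact hfc.contDiffAt
    exact contDiffAt_snd.comp t (h1.comp t
      (by fun_prop : ContDiffAt ℝ ∞ (fun t : ℝ => (t, (0 : E))) t))
  · intro t ht
    obtain ⟨h1, h2⟩ := hfst t ht
    have h3 : (t, (e.symm (t, 0)).2) = e.symm (t, 0) := Prod.ext h1.symm rfl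
    refine ⟨?_, by rw [h3]; exact h2, ?_⟩
    · have := (hεb ht).1.1
      simp only [mem_preimage, ← ball_prod_same] at this
      exact this.2
    · intro x hx hGx
      have hmem : (t, x) ∈ e.source := (hball (by
        rw [← ball_prod_same]; exact ⟨(hεb ht).2, hx⟩)).1
      have h4 := e.left_inv hmem
      rw [hef] at h4
      simp only [hf, hGx] at h4
      exact (congrArg Prod.snd h4).symm

/-- The curve `t ↦ (s ↦ f (t s))` of dilations of `f` in `C([0, 1])`. -/
noncomputable def dilationCurve (f : ℝ → ℝ) (hf : Continuous f) (t : ℝ) : C(I, ℝ) :=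
  ⟨fun s => f (t * s), by fun_prop⟩

/-- The inclusion `[0, 1] → ℝ` as an element of `C([0, 1])`. -/
def inclusionMap : C(I, ℝ) := ⟨fun s => s, continuous_subtype_val⟩

theorem continuous_dilationCurve {f : ℝ → ℝ} (hf : Continuous f) :
    Continuous (dilationCurve f hf) :=
  (ContinuousMap.curry ⟨fun p : ℝ × I => f (p.1 * p.2), by fun_prop⟩).continuous

theorem hasDerivAt_dilationCurve {f : ℝ → ℝ} (hf : ContDiff ℝ ∞ f)
    (hf' : Continuous (deriv f)) (t : ℝ) :
    HasDerivAt (dilationCurve f hf.continuous)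
      (inclusionMap * dilationCurve (deriv f) hf' t) t := by
  have hc : Continuous fun τ => inclusionMap * dilationCurve (deriv f) hf' τ :=
    continuous_const.mul (continuous_dilationCurve hf')
  have heq : dilationCurve f hf.continuous = fun t => dilationCurve f hf.continuous 0 +
      ∫ τ in (0 : ℝ)..t, inclusionMap * dilationCurve (deriv f) hf' τ := by
    ext t s
    have h1 := (ContinuousMap.evalCLM ℝ s : C(I, ℝ) →L[ℝ] ℝ).intervalIntegral_comp_comm
      (hc.intervalIntegrable (μ := MeasureTheory.volume) 0 t)
    have h2 : ∫ τ in (0 : ℝ)..t, (s : ℝ) * deriv f (τ * s) = f (t * s) - f (0 * s) := by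
      refine intervalIntegral.integral_eq_sub_of_hasDerivAt (f := fun τ => f (τ * s)) ?_
        ((by fun_prop : Continuous fun τ : ℝ => (s : ℝ) * deriv f (τ * s)).intervalIntegrable _ _)
      intro τ _
      have h3 := ((hf.differentiable (by simp)).differentiableAt (x := τ * s)).hasDerivAt.comp τ
        ((hasDerivAt_id τ).mul_const (s : ℝ))
      simpa [Function.comp_def, mul_comm] using h3
    have h4 : (∫ τ in (0 : ℝ)..t, inclusionMap * dilationCurve (deriv f) hf' τ) s =
        f (t * s) - f (0 * s) := by
      rw [← h2]; exact h1.symm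
    rw [ContinuousMap.add_apply, h4]
    simp [dilationCurve]
  rw [heq]
  exact (hc.integral_hasStrictDerivAt 0 t).hasDerivAt.const_add _

theorem contDiff_dilationCurve {f : ℝ → ℝ} (hf : ContDiff ℝ ∞ f) :
    ContDiff ℝ ∞ (dilationCurve f hf.continuous) := by
  rw [contDiff_infty]
  intro k
  induction k generalizing f with
  | zero => exact contDiff_zero.2 (continuous_dilationCurve hf.continuous)
  | succ k ih =>
    have hf' : ContDiff ℝ ∞ (deriv f) := (contDiff_infty_iff_deriv.1 hf).2
    have hd := hasDerivAt_dilationCurve hf hf'.continuous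
    rw [Nat.cast_add, Nat.cast_one, contDiff_succ_iff_deriv]
    refine ⟨fun t => (hd t).differentiableAt, by simp, ?_⟩
    rw [funext fun t => (hd t).deriv]
    exact contDiff_const.mul (ih hf')

/-- The averaging operator `Q ↦ (s ↦ ∫₀¹ r ^ k Q (s r) dr)` on `C([0, 1])`. -/
noncomputable def averageCLM (k : ℕ) : C(I, ℝ) →L[ℝ] C(I, ℝ) :=
  LinearMap.mkContinuous
    { toFun := fun Q => ⟨fun s => ∫ r in (0 : ℝ)..1, r ^ k * Q (s * projIcc 0 1 zero_le_one r),
        intervalIntegral.continuous_parametric_intervalIntegral_of_continuous'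
          (by fun_prop) 0 1⟩
      map_add' := fun P Q => by
        ext s
        simp only [ContinuousMap.add_apply, ContinuousMap.coe_mk, mul_add]
        exact intervalIntegral.integral_add
          (Continuous.intervalIntegrable (by fun_prop) _ _)
          (Continuous.intervalIntegrable (by fun_prop) _ _)
      map_smul' := fun c Q => by
        ext s
        simp [← intervalIntegral.integral_const_mul, mul_left_comm] }
    1 fun Q => by
      rw [one_mul]
      refine (ContinuousMap.norm_le _ (norm_nonneg Q)).2 fun s => ?_
      have h := intervalIntegral.norm_integral_le_of_norm_le_const (a := 0) (b := 1) (C := ‖Q‖)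
        (f := fun r : ℝ => r ^ k * Q (s * projIcc 0 1 zero_le_one r)) fun r hr => by
          rw [uIoc_of_le zero_le_one] at hr
          rw [norm_mul, norm_pow, Real.norm_of_nonneg hr.1.le]
          exact (mul_le_of_le_one_left (norm_nonneg _) (pow_le_one₀ hr.1.le hr.2)).trans
            (Q.norm_coe_le_norm _)
      simpa using h

theorem averageCLM_apply (k : ℕ) (Q : C(I, ℝ)) (s : I) :
    averageCLM k Q s = ∫ r in (0 : ℝ)..1, r ^ k * Q (s * projIcc 0 1 zero_le_one r) := rfl

theorem averageCLM_const (k : ℕ) (b : ℝ) :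
    averageCLM k (ContinuousMap.const I b) = ContinuousMap.const I (b / (k + 1)) := by
  ext s
  simp [averageCLM_apply, div_eq_inv_mul]

/-- The dilation `Q ↦ (x ↦ Q (s x))` of a continuous function on `[0, 1]`. -/
def dilate (s : I) (Q : C(I, ℝ)) : C(I, ℝ) := ⟨fun x => Q (s * x), by fun_prop⟩

theorem averageCLM_dilate (k : ℕ) (s : I) (Q : C(I, ℝ)) :
    averageCLM k (dilate s Q) = dilate s (averageCLM k Q) := by
  ext x
  simp [averageCLM_apply, dilate, mul_assoc]

theorem dilate_mem_ball {s : I} {Q : C(I, ℝ)} {b δ : ℝ}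
    (hQ : Q ∈ Metric.ball (ContinuousMap.const I b) δ) :
    dilate s Q ∈ Metric.ball (ContinuousMap.const I b) δ :=
  lt_of_le_of_lt ((ContinuousMap.dist_le dist_nonneg).2 fun x =>
    ContinuousMap.dist_apply_le_dist (f := Q) (g := ContinuousMap.const I b) (s * x)) hQ

/-- The left-hand side minus the right-hand side of the differential equation, with `n = m + 2`,
rescaled by `t ^ 2` and expressed through the dilations of `q = t v' + n v`, where `w = t ^ 2 v`. -/
noncomputable def rescaledEquation (m : ℕ) {φ ψ : ℝ → ℝ} (hφ : Continuous φ) (hψ : Continuous ψ)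
    (p : ℝ × C(I, ℝ)) : C(I, ℝ) :=
  (p.2 - (m : ℝ) • averageCLM (m + 1) p.2) ^ 2 -
    (1 / ((m : ℝ) + 1)) • ((m : ℝ) • (dilationCurve φ hφ p.1 *
      ((p.1 • inclusionMap) ^ 2 * averageCLM (m + 1) p.2 ^ 2 - (2 : ℝ) • averageCLM (m + 1) p.2)) +
      dilationCurve φ hφ p.1 * dilationCurve ψ hψ p.1)

theorem rescaledEquation_apply (m : ℕ) {φ ψ : ℝ → ℝ} (hφ : Continuous φ) (hψ : Continuous ψ)
    (t : ℝ) (Q : C(I, ℝ)) (s : I) :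
    rescaledEquation m hφ hψ (t, Q) s = (Q s - m * averageCLM (m + 1) Q s) ^ 2 -
      (1 / ((m : ℝ) + 1)) * (m * (φ (t * s) * ((t * s) ^ 2 * averageCLM (m + 1) Q s ^ 2 -
        2 * averageCLM (m + 1) Q s)) + φ (t * s) * ψ (t * s)) := by
  simp [rescaledEquation, dilationCurve, inclusionMap]
  ring

theorem contDiff_rescaledEquation (m : ℕ) {φ ψ : ℝ → ℝ} (hφ : ContDiff ℝ ∞ φ)
    (hψ : ContDiff ℝ ∞ ψ) :
    ContDiff ℝ ∞ (rescaledEquation m hφ.continuous hψ.continuous) := by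
  have h1 := (contDiff_dilationCurve hφ).comp (contDiff_fst (E := ℝ) (F := C(I, ℝ)))
  have h2 := (contDiff_dilationCurve hψ).comp (contDiff_fst (E := ℝ) (F := C(I, ℝ)))
  have h3 := (averageCLM (m + 1)).contDiff.comp (contDiff_snd (E := ℝ) (F := C(I, ℝ)) (n := ∞))
  have h4 : ContDiff ℝ ∞ fun p : ℝ × C(I, ℝ) => p.1 • inclusionMap :=
    contDiff_fst.smul contDiff_const
  exact ((contDiff_snd.sub (h3.const_smul _)).pow 2).sub (((((h1.mul
    (((h4.pow 2).mul (h3.pow 2)).sub (h3.const_smul _))).const_smul _).add (h1.mul h2))).const_smul _)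

theorem rescaledEquation_dilate (m : ℕ) {φ ψ : ℝ → ℝ} (hφ : Continuous φ) (hψ : Continuous ψ)
    (t : ℝ) (Q : C(I, ℝ)) (s : I) :
    rescaledEquation m hφ hψ (t * s, dilate s Q) = dilate s (rescaledEquation m hφ hψ (t, Q)) := by
  ext x
  simp only [rescaledEquation_apply, averageCLM_dilate]
  simp [dilate, rescaledEquation_apply, mul_assoc]

theorem rescaledEquation_zero (m : ℕ) {φ ψ : ℝ → ℝ} (hφ : Continuous φ) (hψ : Continuous ψ)
    (h0 : φ 0 = ψ 0) {a : ℝ} (ha : φ 0 = (m + 1) * a) (Q : C(I, ℝ)) :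
    rescaledEquation m hφ hψ (0, Q) =
      (2 * a) • (Q - ContinuousMap.const I ((m + 2) * a / 2)) +
        ((Q - ContinuousMap.const I ((m + 2) * a / 2)) -
          (m : ℝ) • averageCLM (m + 1) (Q - ContinuousMap.const I ((m + 2) * a / 2))) ^ 2 := by
  ext s
  rw [map_sub, averageCLM_const, rescaledEquation_apply]
  simp only [zero_mul, ← h0, ha, ContinuousMap.add_apply, ContinuousMap.smul_apply,
    ContinuousMap.sub_apply, ContinuousMap.pow_apply, ContinuousMap.const_apply, smul_eq_mul]
  have : (m : ℝ) + 1 ≠ 0 := by positivity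
  have : (m : ℝ) + 2 ≠ 0 := by positivity
  have : ((m + 1 : ℕ) : ℝ) + 1 = m + 2 := by push_cast; ring
  rw [this]
  field_simp
  ring

theorem hasFDerivAt_rescaledEquation_zero (m : ℕ) {φ ψ : ℝ → ℝ} (hφ : Continuous φ)
    (hψ : Continuous ψ) (h0 : φ 0 = ψ 0) {a : ℝ} (ha : φ 0 = (m + 1) * a) :
    HasFDerivAt (fun Q => rescaledEquation m hφ hψ (0, Q))
      ((2 * a) • ContinuousLinearMap.id ℝ C(I, ℝ)) (ContinuousMap.const I ((m + 2) * a / 2)) := by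
  set Q₀ := ContinuousMap.const I ((m + 2) * a / 2) with hQ₀
  rw [funext (rescaledEquation_zero m hφ hψ h0 ha)]
  have h1 : HasFDerivAt (fun Q => Q - Q₀) (ContinuousLinearMap.id ℝ C(I, ℝ)) Q₀ :=
    (hasFDerivAt_id Q₀).sub_const Q₀
  have h2 := h1.sub (((averageCLM (m + 1)).hasFDerivAt.comp Q₀ h1).const_smul (m : ℝ))
  have h3 := (h1.const_smul (2 * a)).add (h2.pow 2)
  refine h3.congr_fderiv ?_
  ext h s
  simp

/-- If `v` averages the dilations of `q`, then `t v' + (m + 2) v = q`, and `w = t ^ 2 v` satisfies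
`w' = t (q - m v)`. -/
theorem hasDerivAt_sq_mul_of_average {ε : ℝ} {q v : ℝ → ℝ} {m : ℕ}
    (hq : ContinuousOn q (Metric.ball 0 ε)) (hv : DifferentiableOn ℝ v (Metric.ball 0 ε))
    (hqv : ∀ t ∈ Metric.ball (0 : ℝ) ε, v t = ∫ r in (0 : ℝ)..1, r ^ (m + 1) * q (t * r))
    {t : ℝ} (ht : t ∈ Metric.ball (0 : ℝ) ε) :
    HasDerivAt (fun t => t ^ 2 * v t) (t * (q t - m * v t)) t := by
  have hvd := (hv.differentiableAt (Metric.isOpen_ball.mem_nhds ht)).hasDerivAt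
  have hw := (hasDerivAt_pow 2 t).mul hvd
  refine hw.congr_deriv ?_
  suffices h : t ≠ 0 → t * deriv v t + (m + 2) * v t = q t by
    rcases eq_or_ne t 0 with rfl | h'
    · simp
    · rw [← h h']; simp; ring
  intro ht0
  have hprim : ∀ u ∈ Metric.ball (0 : ℝ) ε,
      u ^ (m + 2) * v u = ∫ τ in (0 : ℝ)..u, τ ^ (m + 1) * q τ := by
    intro u hu
    have h1 := intervalIntegral.mul_integral_comp_mul_left (a := 0) (b := 1) u
      (f := fun τ => τ ^ (m + 1) * q τ)
    rw [mul_zero, mul_one] at h1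
    rw [hqv u hu, ← h1, pow_succ' u (m + 1), mul_assoc, ← intervalIntegral.integral_const_mul]
    simp only [mul_pow, mul_assoc]
  have hsub : uIcc 0 t ⊆ Metric.ball 0 ε := by
    rw [← segment_eq_uIcc]
    exact (convex_ball 0 ε).segment_subset
      (Metric.mem_ball_self (Metric.pos_of_mem_ball ht)) ht
  have hc : ContinuousOn (fun τ => τ ^ (m + 1) * q τ) (Metric.ball 0 ε) :=
    (continuous_pow _).continuousOn.mul hq
  have h1 : HasDerivAt (fun u => ∫ τ in (0 : ℝ)..u, τ ^ (m + 1) * q τ) (t ^ (m + 1) * q t) t :=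
    intervalIntegral.integral_hasDerivAt_right (hc.mono hsub).intervalIntegrable
      (hc.stronglyMeasurableAtFilter Metric.isOpen_ball t ht)
      (hc.continuousAt (Metric.isOpen_ball.mem_nhds ht))
  have h2 : HasDerivAt (fun u => u ^ (m + 2) * v u) (t ^ (m + 1) * q t) t :=
    h1.congr_of_eventuallyEq (Filter.mem_of_superset (Metric.isOpen_ball.mem_nhds ht) hprim)
  have h3 := h2.unique ((hasDerivAt_pow (m + 2) t).mul hvd)
  apply mul_left_cancel₀ (pow_ne_zero (m + 1) ht0)
  rw [h3]
  push_cast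
  ring

theorem exists_rescaled_solution (m : ℕ) {φ ψ : ℝ → ℝ} (hφ : ContDiff ℝ ∞ φ)
    (hψ : ContDiff ℝ ∞ ψ) (h0 : φ 0 = ψ 0) {a : ℝ} (ha : φ 0 = (m + 1) * a) (ha0 : a ≠ 0) :
    ∃ ε > 0, ∃ q v : ℝ → ℝ, ContDiffOn ℝ ∞ q (Metric.ball 0 ε) ∧
      ContDiffOn ℝ ∞ v (Metric.ball 0 ε) ∧ q 0 - m * v 0 = a ∧
      ∀ t ∈ Metric.ball (0 : ℝ) ε, v t = ∫ r in (0 : ℝ)..1, r ^ (m + 1) * q (t * r) ∧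
        (q t - m * v t) ^ 2 = (1 / ((m : ℝ) + 1)) *
          (m * (φ t * (t ^ 2 * v t ^ 2 - 2 * v t)) + φ t * ψ t) := by
  have h2a : 2 * a ≠ 0 := mul_ne_zero two_ne_zero ha0
  obtain ⟨δ, hδ, ε, hε, X, hX, hsol⟩ := exists_smooth_implicit_curve
    (contDiff_rescaledEquation m hφ hψ) (x₀ := ContinuousMap.const I ((m + 2) * a / 2))
    (by rw [rescaledEquation_zero m hφ.continuous hψ.continuous h0 ha]; simp)
    (B := ContinuousLinearEquiv.smulLeft (Units.mk0 (2 * a) h2a))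
    ((hasFDerivAt_rescaledEquation_zero m hφ.continuous hψ.continuous h0 ha).congr_fderiv rfl)
  have hX0 : X 0 = ContinuousMap.const I ((m + 2) * a / 2) :=
    ((hsol 0 (Metric.mem_ball_self hε)).2.2 _ (Metric.mem_ball_self hδ)
      (by rw [rescaledEquation_zero m hφ.continuous hψ.continuous h0 ha]; simp)).symm
  have hdil : ∀ t ∈ Metric.ball (0 : ℝ) ε, ∀ s : I, X (t * s) = dilate s (X t) := by
    intro t ht s
    have hts : t * s ∈ Metric.ball (0 : ℝ) ε := by
      rw [mem_ball_zero_iff, norm_mul, Real.norm_of_nonneg s.2.1] at *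
      exact (mul_le_of_le_one_right (norm_nonneg t) s.2.2).trans_lt ht
    refine ((hsol _ hts).2.2 _ (dilate_mem_ball (hsol t ht).1) ?_).symm
    rw [rescaledEquation_dilate, (hsol t ht).2.1]
    rfl
  refine ⟨ε, hε, fun t => X t 1, fun t => averageCLM (m + 1) (X t) 1,
    (ContinuousMap.evalCLM ℝ (1 : I) : C(I, ℝ) →L[ℝ] ℝ).contDiff.comp_contDiffOn hX,
    ((ContinuousMap.evalCLM ℝ (1 : I) : C(I, ℝ) →L[ℝ] ℝ).comp
      (averageCLM (m + 1))).contDiff.comp_contDiffOn hX, ?_, ?_⟩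
  · have : (m : ℝ) + 2 ≠ 0 := by positivity
    have : ((m + 1 : ℕ) : ℝ) + 1 = m + 2 := by push_cast; ring
    simp only [hX0, averageCLM_const, ContinuousMap.const_apply, this]
    field_simp
    ring
  · intro t ht
    constructor
    · simp only [averageCLM_apply]
      refine intervalIntegral.integral_congr fun r hr => ?_
      rw [uIcc_of_le zero_le_one] at hr
      have h := hdil t ht ⟨r, hr⟩
      simp only at h
      simp only [h, dilate, projIcc_of_mem zero_le_one hr, ContinuousMap.coe_mk, one_mul, mul_one]
    · have h := congrArg (fun Q : C(I, ℝ) => Q 1) (hsol t ht).2.1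
      simp only [rescaledEquation_apply, ContinuousMap.zero_apply, Icc.coe_one,
        mul_one] at h
      exact sub_eq_zero.1 h

/-- Existence of a smooth local solution of the implicit differential equation (9)
`(w')² = (1/(n−1))·[(n−2)·φ·(w² − 2w) + t²·φ·ψ]` with `w(0) = w'(0) = 0` and
`w'(t)·φ(0) > 0` for `t > 0`. -/
theorem stmt_3 (n : ℕ) (hn : 2 ≤ n) (φ ψ : ℝ → ℝ)
    (hφ : ContDiff ℝ (⊤ : ℕ∞) φ) (hψ : ContDiff ℝ (⊤ : ℕ∞) ψ)
    (h0 : φ 0 = ψ 0) (hne : φ 0 ≠ 0) :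
    ∃ ε : ℝ, 0 < ε ∧ ∃ w : ℝ → ℝ,
      ContDiffOn ℝ (⊤ : ℕ∞) w (Set.Ico 0 ε) ∧
      w 0 = 0 ∧
      derivWithin w (Set.Ici 0) 0 = 0 ∧
      (∀ t ∈ Set.Ico (0 : ℝ) ε,
        (derivWithin w (Set.Ici 0) t) ^ 2 =
          (1 / ((n : ℝ) - 1)) *
            (((n : ℝ) - 2) * φ t * ((w t) ^ 2 - 2 * w t) + t ^ 2 * φ t * ψ t)) ∧
      ∀ t ∈ Set.Ioo (0 : ℝ) ε, 0 < derivWithin w (Set.Ici 0) t * φ 0 := by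
  obtain ⟨m, rfl⟩ := Nat.exists_eq_add_of_le' hn
  have hm : (0 : ℝ) < m + 1 := by positivity
  obtain ⟨ε, hε, q, v, hq, hv, hpa, hqv⟩ := exists_rescaled_solution m hφ hψ h0
    (a := φ 0 / (m + 1)) (by field_simp) (div_ne_zero hne hm.ne')
  have hpos : ∀ᶠ t in 𝓝 (0 : ℝ), 0 < (q t - m * v t) * φ 0 := by
    have hb := Metric.ball_mem_nhds (0 : ℝ) hε
    have hcont : ContinuousAt (fun t => (q t - m * v t) * φ 0) 0 :=
      ((hq.continuousOn.continuousAt hb).sub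
        (continuousAt_const.mul (hv.continuousOn.continuousAt hb))).mul continuousAt_const
    refine hcont.eventually (lt_mem_nhds ?_)
    simp only [hpa, div_mul_eq_mul_div]
    exact div_pos (mul_self_pos.2 hne) hm
  obtain ⟨η, hη, hηb⟩ := Metric.mem_nhds_iff.1 (inter_mem hpos (Metric.ball_mem_nhds 0 hε))
  have hsub : Ico 0 η ⊆ Metric.ball (0 : ℝ) η := fun t ht => by
    rw [mem_ball_zero_iff, Real.norm_of_nonneg ht.1]; exact ht.2
  have hd : ∀ t ∈ Ico 0 η, derivWithin (fun t => t ^ 2 * v t) (Ici 0) t =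
      t * (q t - m * v t) := fun t ht =>
    (hasDerivAt_sq_mul_of_average hq.continuousOn (hv.differentiableOn (by simp))
      (fun s hs => (hqv s hs).1) (hηb (hsub ht)).2).hasDerivWithinAt.derivWithin
      (uniqueDiffOn_Ici 0 t ht.1)
  refine ⟨η, hη, fun t => t ^ 2 * v t, ?_, by simp, ?_, ?_, ?_⟩
  · exact (contDiff_id.pow 2).contDiffOn.mul (hv.mono fun t ht => (hηb (hsub ht)).2)
  · rw [hd 0 ⟨le_rfl, hη⟩, zero_mul]
  · intro t ht
    rw [hd t ht, mul_pow, (hqv t (hηb (hsub ht)).2).2]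
    have : ((m + 2 : ℕ) : ℝ) - 1 = m + 1 := by push_cast; ring
    have : ((m + 2 : ℕ) : ℝ) - 2 = m := by push_cast; ring
    simp only [*]
    ring
  · intro t ht
    rw [hd t ⟨ht.1.le, ht.2⟩, mul_assoc]
    exact mul_pos ht.1 (hηb (hsub ⟨ht.1.le, ht.2⟩)).1
end

section
/- Let n ≥ 3 be an integer and let φ, ψ : ℝ → ℝ be C^∞ functions with φ(0) = ψ(0) ≠ 0 and φ(t)·ψ(t) > 0 for all t ≥ 0. Define F(t, w, p) = (1/(n−1))·[(n−2)·φ(t)·(w² − 2w) + t²·φ(t)·ψ(t)] − p². Assume: (i) for every (t, w, p) with t ≥ 0 and F(t, w, p) = 0, the gradient (∂F/∂t, ∂F/∂w, ∂F/∂p)(t, w, p) is nonzero; and (ii) (d/dt)(t²·ψ(t))·φ(t) ≠ 0 for all t > 0. Then there exists a function w : ℝ → ℝ which is C^∞ on [0, ∞), with w(0) = 0, w'(0) = 0, (w'(t))² = (1/(n−1))·[(n−2)·φ(t)·(w(t)² − 2·w(t)) + t²·φ(t)·ψ(t)] for all t ≥ 0, and w'(t)·φ(0) > 0 for all t > 0.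 -/
open MeasureTheory Set Filter Topology
open scoped ContDiff

theorem contDiff_intervalIntegral_nat {E : Type} [NormedAddCommGroup E] [NormedSpace ℝ E]
    [FiniteDimensional ℝ E] (k : ℕ) :
    ∀ {F : Type} [NormedAddCommGroup F] [NormedSpace ℝ F] [CompleteSpace F] {f : ℝ × E → F},
      ContDiff ℝ ∞ f → ∀ a b : ℝ, ContDiff ℝ k (fun x => ∫ s in a..b, f (s, x)) := by
  have := FiniteDimensional.proper ℝ E
  induction k with
  | zero =>
    intro F _ _ _ f hf a b
    refine contDiff_zero.2 ?_
    refine intervalIntegral.continuous_parametric_intervalIntegral_of_continuous'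
      (f := fun x s => f (s, x)) ?_ a b
    exact hf.continuous.comp (by fun_prop)
  | succ k ih =>
    intro F _ _ _ f hf a b
    set f' : ℝ × E → (E →L[ℝ] F) := fun p =>
      (fderiv ℝ f p).comp (ContinuousLinearMap.inr ℝ ℝ E) with hf'
    have hf's : ContDiff ℝ ∞ f' :=
      (hf.fderiv_right (m := ∞) (by simp)).clm_comp contDiff_const
    have hd : ∀ s x, HasFDerivAt (fun x => f (s, x)) (f' (s, x)) x := fun s x =>
      ((hf.differentiable (by simp)) (s, x)).hasFDerivAt.comp x (hasFDerivAt_prodMk_right s x)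
    have key : ∀ x, HasFDerivAt (fun x => ∫ s in a..b, f (s, x)) (∫ s in a..b, f' (s, x)) x := by
      intro x
      obtain ⟨C, hC⟩ := (isCompact_uIcc (a := a) (b := b)).prod (isCompact_closedBall x 1)
        |>.exists_bound_of_continuousOn hf's.continuous.continuousOn
      refine (intervalIntegral.hasFDerivAt_integral_of_dominated_of_fderiv_le
        (F := fun x s => f (s, x)) (F' := fun x s => f' (s, x)) (bound := fun _ => C)
        (Metric.ball_mem_nhds x one_pos) ?_ ?_ ?_ ?_ ?_ ?_)
      · exact Eventually.of_forall fun x =>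
          (hf.continuous.comp (by fun_prop : Continuous fun s : ℝ => (s, x))).aestronglyMeasurable
      · exact (hf.continuous.comp (by fun_prop : Continuous fun s : ℝ => (s, x))).intervalIntegrable _ _
      · exact (hf's.continuous.comp
          (by fun_prop : Continuous fun s : ℝ => (s, x))).aestronglyMeasurable
      · exact Eventually.of_forall fun s hs y hy =>
          hC (s, y) ⟨uIoc_subset_uIcc hs, Metric.ball_subset_closedBall hy⟩
      · exact intervalIntegrable_const
      · exact Eventually.of_forall fun s hs y hy => hd s y
    have : ((k + 1 : ℕ) : WithTop ℕ∞) = k + 1 := by push_cast; rfl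
    rw [this, contDiff_succ_iff_hasFDerivAt]
    exact ⟨_, ih hf's a b, key⟩

theorem exists_eq_fst_mul_of_contDiff {g : ℝ × ℝ → ℝ} (hg : ContDiff ℝ ∞ g)
    (h0 : ∀ y, g (0, y) = 0) :
    ∃ h : ℝ × ℝ → ℝ, ContDiff ℝ ∞ h ∧ ∀ t y, g (t, y) = t * h (t, y) := by
  set d : ℝ × ℝ → ℝ := fun p => fderiv ℝ g p (1, 0)
  have hds : ContDiff ℝ ∞ d :=
    (hg.fderiv_right (m := ∞) (by simp)).clm_apply contDiff_const
  refine ⟨fun p => ∫ s in (0 : ℝ)..1, d (s * p.1, p.2), ?_, ?_⟩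
  · refine contDiff_infty.2 fun k => ?_
    refine contDiff_intervalIntegral_nat (E := ℝ × ℝ) k
      (f := fun q => d (q.1 * q.2.1, q.2.2)) ?_ 0 1
    exact hds.comp (by fun_prop)
  · intro t y
    have hder : ∀ s : ℝ, HasDerivAt (fun s => g (s * t, y)) (t * d (s * t, y)) s := by
      intro s
      have h1 : HasDerivAt (fun s : ℝ => (s * t, y)) (t, 0) s := by
        have := ((hasDerivAt_id s).mul_const t).prodMk (hasDerivAt_const s y)
        simpa using this
      have h2 := ((hg.differentiable (by simp)) (s * t, y)).hasFDerivAt.comp_hasDerivAt s h1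
      have h3 : fderiv ℝ g (s * t, y) (t, 0) = t * d (s * t, y) := by
        have : ((t, 0) : ℝ × ℝ) = t • (1, 0) := by simp
        rw [this, map_smul, smul_eq_mul]
      exact h3 ▸ h2
    have := intervalIntegral.integral_eq_sub_of_hasDerivAt (a := 0) (b := 1)
      (fun s _ => hder s) ?_
    · rw [intervalIntegral.integral_const_mul] at this
      simp only [one_mul, zero_mul, h0, sub_zero] at this
      exact this.symm
    · refine Continuous.intervalIntegrable ?_ _ _
      exact continuous_const.mul (hds.continuous.comp (by fun_prop))

theorem contDiffOn_succ_of_hasDerivWithinAt {k : ℕ} {s : Set ℝ} (hs : UniqueDiffOn ℝ s)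
    {f f' : ℝ → ℝ} (h : ∀ t ∈ s, HasDerivWithinAt f (f' t) s t) (hf' : ContDiffOn ℝ k f' s) :
    ContDiffOn ℝ (k + 1 : ℕ) f s := by
  have : ((k + 1 : ℕ) : WithTop ℕ∞) = k + 1 := by push_cast; rfl
  rw [this, contDiffOn_succ_iff_derivWithin hs]
  refine ⟨fun t ht => (h t ht).differentiableWithinAt, by simp, ?_⟩
  exact hf'.congr fun t ht => (h t ht).derivWithin (hs t ht)

theorem le_mul_of_deriv_lt {x x' : ℝ → ℝ} {δ C : ℝ}
    (hx : ∀ t ∈ Ioo 0 δ, HasDerivAt x (x' t) t) (hx0 : Tendsto x (𝓝[>] 0) (𝓝 0))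
    (h : ∀ t ∈ Ioo 0 δ, C * t < x t → x' t < C) (t : ℝ) (ht : t ∈ Ioo 0 δ) : x t ≤ C * t := by
  refine le_of_forall_pos_le_add fun η hη => ?_
  obtain ⟨s, hs1, hs2⟩ : ∃ s, s ∈ Ioo 0 t ∧ x s - C * s < η := by
    have h1 : Tendsto (fun s => x s - C * s) (𝓝[>] 0) (𝓝 (0 - C * 0)) :=
      hx0.sub ((tendsto_id.const_mul C).mono_left nhdsWithin_le_nhds)
    have h2 : ∀ᶠ s in 𝓝[>] (0 : ℝ), x s - C * s < η := h1.eventually_lt_const (by simpa using hη)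
    exact (Filter.Eventually.and (Ioo_mem_nhdsGT ht.1) h2).exists
  have hsub : ∀ r ∈ Icc s t, r ∈ Ioo 0 δ := fun r hr =>
    ⟨hs1.1.trans_le hr.1, hr.2.trans_lt ht.2⟩
  have := image_le_of_deriv_right_lt_deriv_boundary' (f := x) (f' := x') (a := s) (b := t)
    (B := fun r => C * r + η) (B' := fun _ => C)
    (fun r hr => (hx r (hsub r hr)).continuousAt.continuousWithinAt)
    (fun r hr => (hx r (hsub r (Ico_subset_Icc_self hr))).hasDerivWithinAt)
    (by linarith) (by fun_prop)
    (fun r _ => by simpa using (((hasDerivAt_id r).const_mul C).add_const η).hasDerivWithinAt)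
    (fun r hr he => h r (hsub r (Ico_subset_Icc_self hr)) (by rw [he]; linarith))
    (right_mem_Icc.2 hs1.2.le)
  exact this

theorem tendsto_div_of_singular_linear {x α γ : ℝ → ℝ} {δ α₀ l : ℝ} (hδ : 0 < δ) (hl : 0 < l)
    (hx : ∀ t ∈ Ioo 0 δ, HasDerivAt x (α t - γ t * (x t / t)) t)
    (hα : Tendsto α (𝓝[>] 0) (𝓝 α₀)) (hγ : Tendsto γ (𝓝[>] 0) (𝓝 l))
    (hx0 : Tendsto x (𝓝[>] 0) (𝓝 0)) :
    Tendsto (fun t => x t / t) (𝓝[>] 0) (𝓝 (α₀ / (1 + l))) := by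
  set m := α₀ / (1 + l) with hm
  have hβ : Tendsto (fun t => α t - m * (1 + γ t)) (𝓝[>] 0) (𝓝 0) := by
    have := hα.sub ((hγ.const_add 1).const_mul m)
    have e : α₀ - m * (1 + l) = 0 := by rw [hm]; field_simp; ring
    rwa [e] at this
  rw [Metric.tendsto_nhds]
  intro ε hε
  have e1 : ∀ᶠ t in 𝓝[>] (0 : ℝ), |α t - m * (1 + γ t)| < ε / 2 * (l / 2) := by
    have := (Metric.tendsto_nhds.1 hβ) (ε / 2 * (l / 2)) (by positivity)
    simpa [Real.dist_eq] using this
  have e2 : ∀ᶠ t in 𝓝[>] (0 : ℝ), l / 2 < γ t := hγ.eventually_const_lt (by linarith)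
  obtain ⟨δ', hδ', hd⟩ := (mem_nhdsGT_iff_exists_Ioo_subset).1
    ((e1.and e2).and (Ioo_mem_nhdsGT hδ : ∀ᶠ t in 𝓝[>] (0 : ℝ), t ∈ Ioo 0 δ))
  have hX0 : Tendsto (fun t => x t - m * t) (𝓝[>] 0) (𝓝 0) := by
    have := hx0.sub ((tendsto_id.const_mul m).mono_left (nhdsWithin_le_nhds (s := Ioi (0 : ℝ))))
    simpa using this
  have hX : ∀ t ∈ Ioo 0 δ', HasDerivAt (fun t => x t - m * t) (α t - γ t * (x t / t) - m) t := by
    intro t ht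
    simpa using (hx t (hd ht).2).fun_sub ((hasDerivAt_id t).const_mul m)
  have key : ∀ t ∈ Ioo 0 δ', α t - γ t * (x t / t) - m
      = (α t - m * (1 + γ t)) - γ t * ((x t - m * t) / t) := by
    intro t ht
    have := ht.1.ne'
    field_simp
    ring
  have up := le_mul_of_deriv_lt (C := ε / 2) hX hX0 fun t ht hlt => by
    obtain ⟨⟨h1, h2⟩, -⟩ := hd ht
    have h1 : |α t - m * (1 + γ t)| < ε / 2 * (l / 2) := h1
    have h2 : l / 2 < γ t := h2
    have h3 : ε / 2 < (x t - m * t) / t := (lt_div_iff₀ ht.1).2 hlt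
    rw [key t ht]
    have h4 := (abs_lt.1 h1).2
    nlinarith
  have hX0' : Tendsto (fun t => -(x t - m * t)) (𝓝[>] 0) (𝓝 0) := by simpa using hX0.neg
  have lo := le_mul_of_deriv_lt (C := ε / 2) (fun t ht => (hX t ht).fun_neg) hX0'
    fun t ht hlt => by
    obtain ⟨⟨h1, h2⟩, -⟩ := hd ht
    have h1 : |α t - m * (1 + γ t)| < ε / 2 * (l / 2) := h1
    have h2 : l / 2 < γ t := h2
    have h3 : ε / 2 < -(x t - m * t) / t := (lt_div_iff₀ ht.1).2 hlt
    rw [neg_div] at h3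
    rw [key t ht]
    have h4 := (abs_lt.1 h1).1
    nlinarith
  filter_upwards [Ioo_mem_nhdsGT hδ'] with t ht
  have a := up t ht
  have b := lo t ht
  have : x t / t - m = (x t - m * t) / t := by
    have := ht.1.ne'
    field_simp
  rw [Real.dist_eq, this, abs_div, abs_of_pos ht.1, div_lt_iff₀ ht.1]
  have := ht.1
  exact lt_of_le_of_lt (abs_le.2 ⟨by linarith, a⟩) (by nlinarith)

theorem exists_contDiffOn_nat_of_singular (k : ℕ) :
    ∀ {G : ℝ × ℝ → ℝ} {l : ℝ} {x : ℝ → ℝ} {δ : ℝ}, ContDiff ℝ ∞ G → G (0, 0) = 0 → 0 < l →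
      HasDerivAt (fun y => G (0, y)) (-l) 0 → 0 < δ → x 0 = 0 → Tendsto x (𝓝[>] 0) (𝓝 0) →
      (∀ t ∈ Ioo 0 δ, HasDerivAt x (G (t, x t) / t) t) →
      ∃ ε > 0, ContDiffOn ℝ k x (Ico 0 ε) := by
  induction k with
  | zero =>
    intro G l x δ _ _ _ _ hδ hx0 hx hxd
    refine ⟨δ, hδ, contDiffOn_zero.2 fun t ht => ?_⟩
    rcases ht.1.eq_or_lt with rfl | h
    · have : ContinuousWithinAt x (Ioi 0) 0 := by rw [ContinuousWithinAt, hx0]; exact hx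
      exact (continuousWithinAt_Ioi_iff_Ici.1 this).mono Ico_subset_Ici_self
    · exact (hxd t ⟨h, ht.2⟩).continuousAt.continuousWithinAt
  | succ k ih =>
    intro G l x δ hG hG0 hl hGd hδ hx0 hx hxd
    obtain ⟨A', hA', hA'e⟩ := exists_eq_fst_mul_of_contDiff (g := fun p => G (p.1, 0))
      (hG.comp (by fun_prop)) (fun _ => hG0)
    obtain ⟨B, hB, hBe⟩ := exists_eq_fst_mul_of_contDiff
      (g := fun p => G (p.2, p.1) - G (p.2, 0))
      ((hG.comp (by fun_prop)).sub (hG.comp (by fun_prop))) (fun _ => sub_self _)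
    set A : ℝ → ℝ := fun t => A' (t, 0) with hAdef
    have hA : ContDiff ℝ ∞ A := hA'.comp (by fun_prop)
    have hGe : ∀ t y, G (t, y) = t * A t + y * B (y, t) := fun t y => by
      have h1 := hA'e t 0
      have h2 := hBe y t
      simp only at h1 h2
      simp only [hAdef]
      linarith
    have hB0 : B (0, 0) = -l := by
      have hc : HasDerivAt (fun y => B (y, 0)) (deriv (fun y => B (y, 0)) 0) 0 := by
        have : ContDiff ℝ ∞ fun y => B (y, 0) := hB.comp (by fun_prop)
        exact (this.differentiable (by simp) 0).hasDerivAt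
      have h1 := (hasDerivAt_id (0 : ℝ)).mul hc
      have h2 : (fun y => G (0, y)) = id * fun y => B (y, 0) := by
        ext y; simp [hGe]
      rw [h2] at hGd
      simpa using h1.unique hGd
    have hid : Tendsto (fun t : ℝ => t) (𝓝[>] 0) (𝓝 0) := tendsto_id.mono_left nhdsWithin_le_nhds
    have hAt : Tendsto A (𝓝[>] 0) (𝓝 (A 0)) := (hA.continuous.tendsto 0).comp hid
    have hBt : Tendsto (fun t => -B (x t, t)) (𝓝[>] 0) (𝓝 l) := by
      have := ((hB.continuous.tendsto (0, 0)).comp (hx.prodMk_nhds hid)).neg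
      simpa [hB0] using this
    have hsl := tendsto_div_of_singular_linear hδ hl (x := x) (α := A)
      (γ := fun t => -B (x t, t)) (fun t ht => by
        convert hxd t ht using 1
        rw [hGe]
        have := ht.1.ne'
        field_simp
        ring) hAt hBt hx
    set m := A 0 / (1 + l) with hm
    set y : ℝ → ℝ := fun t => if t = 0 then 0 else x t / t - m with hy
    have hyx : ∀ t, x t = t * (y t + m) := by
      intro t
      by_cases h : t = 0
      · simp [h, hx0]
      · simp only [hy, h, if_false]; field_simp; ring
    set G₁ : ℝ × ℝ → ℝ := fun p => A p.1 + (p.2 + m) * (B (p.1 * (p.2 + m), p.1) - 1) with hG₁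
    have hG₁s : ContDiff ℝ ∞ G₁ := by
      have h1 : ContDiff ℝ ∞ fun p : ℝ × ℝ => A p.1 := hA.comp contDiff_fst
      have h2 : ContDiff ℝ ∞ fun p : ℝ × ℝ => B (p.1 * (p.2 + m), p.1) := hB.comp (by fun_prop)
      exact h1.add (ContDiff.mul (by fun_prop) (h2.sub contDiff_const))
    obtain ⟨ε, hε, hyε⟩ := ih (G := G₁) (l := l + 1) (x := y) (δ := δ) hG₁s
      (by simp only [hG₁, zero_mul, zero_add, hB0, hm]; field_simp; ring) (by linarith)
      (by
        have : (fun v => G₁ (0, v)) = fun v => A 0 + (v + m) * (-l - 1) := by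
          ext v; simp [hG₁, hB0]
        rw [this]
        have := (((hasDerivAt_id (0 : ℝ)).add_const m).mul_const (-l - 1)).const_add (A 0)
        exact this.congr_deriv (by ring))
      hδ (by simp [hy])
      (by
        have h1 : Tendsto (fun t => x t / t - m) (𝓝[>] 0) (𝓝 0) := by
          simpa using hsl.sub_const m
        refine h1.congr' ?_
        filter_upwards [self_mem_nhdsWithin] with t ht
        simp [hy, (mem_Ioi.1 ht).ne'])
      (by
        intro t ht
        have ht0 := ht.1.ne'
        have h1 := ((hxd t ht).div (hasDerivAt_id t) ht0).sub_const m
        have h2 : y =ᶠ[𝓝 t] fun t => x t / t - m := by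
          filter_upwards [isOpen_ne.mem_nhds ht0] with r hr
          simp [hy, (hr : r ≠ 0)]
        refine (h1.congr_of_eventuallyEq h2).congr_deriv ?_
        have hyt : y t + m = x t / t := by simp [hy, ht0]
        have hxt : t * (x t / t) = x t := by field_simp
        simp only [hG₁, hyt, hGe, hxt, id]
        field_simp
        ring)
    refine ⟨min ε δ, lt_min hε hδ, ?_⟩
    have hyε' := hyε.mono (Ico_subset_Ico_right (min_le_left ε δ) : Ico 0 (min ε δ) ⊆ Ico 0 ε)
    refine contDiffOn_succ_of_hasDerivWithinAt (f' := fun t => y t + m + G₁ (t, y t))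
      (uniqueDiffOn_Ico _ _) ?_ ?_
    · intro t ht
      rcases ht.1.eq_or_lt with rfl | h
      · have e : y 0 + m + G₁ (0, y 0) = m := by
          simp only [hG₁, hy, if_true, zero_mul, zero_add, hB0, hm]; field_simp; ring
        rw [e]
        refine HasDerivWithinAt.mono ?_ Ico_subset_Ici_self
        rw [← hasDerivWithinAt_Ioi_iff_Ici, hasDerivWithinAt_iff_tendsto_slope' (by simp)]
        refine hsl.congr fun t => ?_
        simp [slope_def_field, hx0]
      · refine ((hxd t ⟨h, ht.2.trans_le (min_le_right _ _)⟩).congr_deriv ?_).hasDerivWithinAt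
        have := h.ne'
        have e := hyx t
        simp only [hG₁, ← e, hGe]
        have : A t + (y t + m) * B (x t, t) = (t * A t + x t * B (x t, t)) / t := by
          rw [eq_div_iff this, e]; ring
        rw [← this]; ring
    · exact (hyε'.add contDiffOn_const).add
        ((hG₁s.of_le (by exact_mod_cast le_top)).comp_contDiffOn (contDiffOn_id.prodMk hyε'))

theorem exists_lipschitz_snd_of_hasDerivAt_zero {H : ℝ × ℝ → ℝ} (hH : ContDiff ℝ ∞ H)
    (hd : HasDerivAt (fun y => H (0, y)) 0 0) :
    ∃ η > 0, ∀ t ∈ Icc 0 η, ∀ y ∈ Icc (-η) η, ∀ z ∈ Icc (-η) η,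
      |H (t, y) - H (t, z)| ≤ 1 / 2 * |y - z| := by
  have hs := (hH.contDiffAt (x := (0, 0))).hasStrictFDerivAt (by simp)
  set f' := fderiv ℝ H (0, 0)
  have hf' : f' (0, 1) = 0 := by
    have h1 : HasDerivAt (fun y : ℝ => ((0 : ℝ), y)) (0, 1) 0 :=
      (hasDerivAt_const 0 (0 : ℝ)).prodMk (hasDerivAt_id 0)
    exact (hs.hasFDerivAt.comp_hasDerivAt (0 : ℝ) h1).unique hd
  obtain ⟨s, hs, happ⟩ := hs.approximates_deriv_on_nhds (c := 1 / 2) (Or.inr (by norm_num))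
  obtain ⟨r, hr, hrs⟩ := Metric.mem_nhds_iff.1 hs
  have hmem : ∀ t ∈ Icc 0 (r / 2), ∀ y ∈ Icc (-(r / 2)) (r / 2), (t, y) ∈ s := by
    intro t ht y hy
    refine hrs ?_
    rw [Metric.mem_ball, Prod.dist_eq, max_lt_iff, Real.dist_eq, Real.dist_eq, sub_zero, sub_zero,
      abs_lt, abs_lt]
    exact ⟨⟨by linarith [ht.1], by linarith [ht.2]⟩, ⟨by linarith [hy.1], by linarith [hy.2]⟩⟩
  refine ⟨r / 2, by positivity, fun t ht y hy z hz => ?_⟩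
  have h1 := happ _ (hmem t ht y hy) _ (hmem t ht z hz)
  have h2 : ((t, y) : ℝ × ℝ) - (t, z) = (y - z) • (0, 1) := by simp
  rw [h2, map_smul, hf', smul_zero, sub_zero, norm_smul] at h1
  simpa [Prod.norm_def] using h1

theorem exists_singular_integral_equation {K : ℝ × ℝ → ℝ} (hK : Continuous K) {η : ℝ} (hη : 0 < η)
    (hL : ∀ t ∈ Icc 0 η, ∀ y z, |K (t, y) - K (t, z)| ≤ 1 / 2 * |y - z|) (k : ℕ) :
    ∃ x : ℝ → ℝ, Continuous x ∧
      ∀ t ∈ Icc 0 η, x t = ∫ s in (0 : ℝ)..1, s ^ k * K (s * t, x (s * t)) := by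
  have hcont : ∀ x : ℝ → ℝ, Continuous x →
      Continuous fun p : ℝ × ℝ => p.2 ^ k * K (p.2 * p.1, x (p.2 * p.1)) := fun x hx =>
    (by fun_prop : Continuous fun p : ℝ × ℝ => p.2 ^ k).mul (hK.comp (by fun_prop))
  let E : C(Icc 0 η, ℝ) → ℝ → ℝ := fun u => IccExtend hη.le u
  have hE : ∀ u, Continuous (E u) := fun u => u.continuous.Icc_extend'
  let T : C(Icc 0 η, ℝ) → C(Icc 0 η, ℝ) := fun u =>
    ⟨fun t => ∫ s in (0 : ℝ)..1, s ^ k * K (s * t, E u (s * t)),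
      (intervalIntegral.continuous_parametric_intervalIntegral_of_continuous'
        (f := fun t s => s ^ k * K (s * t, E u (s * t))) (hcont _ (hE u)) 0 1).comp
          continuous_subtype_val⟩
  have hT : ContractingWith (1 / 2) T := by
    refine ⟨by rw [← NNReal.coe_lt_coe]; norm_num, LipschitzWith.of_dist_le_mul fun u v => ?_⟩
    refine (ContinuousMap.dist_le (by positivity)).2 fun t => ?_
    have hi : ∀ u, IntervalIntegrable (fun s : ℝ => s ^ k * K (s * t, E u (s * t))) volume 0 1 :=
      fun u => ((hcont _ (hE u)).comp
        (by fun_prop : Continuous fun s : ℝ => ((t : ℝ), s))).intervalIntegrable _ _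
    rw [Real.dist_eq]
    change |(∫ s in (0 : ℝ)..1, s ^ k * K (s * t, E u (s * t))) -
      ∫ s in (0 : ℝ)..1, s ^ k * K (s * t, E v (s * t))| ≤ _
    rw [← intervalIntegral.integral_sub (hi u) (hi v), ← Real.norm_eq_abs]
    have := intervalIntegral.norm_integral_le_of_norm_le_const (a := 0) (b := 1)
      (C := ((1 / 2 : NNReal) : ℝ) * dist u v)
      (f := fun s : ℝ => s ^ k * K (s * t, E u (s * t)) - s ^ k * K (s * t, E v (s * t))) ?_
    · simpa using this
    · intro s hs
      rw [uIoc_of_le zero_le_one] at hs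
      have hst : s * t ∈ Icc 0 η :=
        ⟨mul_nonneg hs.1.le t.2.1, (mul_le_of_le_one_left t.2.1 hs.2).trans t.2.2⟩
      have h1 : s ^ k ≤ 1 := pow_le_one₀ hs.1.le hs.2
      have h2 : 0 ≤ s ^ k := pow_nonneg hs.1.le k
      have h3 := hL _ hst (E u (s * t)) (E v (s * t))
      have h4 : |E u (s * t) - E v (s * t)| ≤ dist u v := by
        rw [← Real.dist_eq]; exact ContinuousMap.dist_apply_le_dist _
      rw [← mul_sub, norm_mul, Real.norm_eq_abs, Real.norm_eq_abs, abs_of_nonneg h2]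
      have h5 : ((1 / 2 : NNReal) : ℝ) = 1 / 2 := by norm_num
      rw [h5]
      have h6 := abs_nonneg (K (s * t, E u (s * t)) - K (s * t, E v (s * t)))
      nlinarith
  have hfix := hT.fixedPoint_isFixedPt
  set u := hT.fixedPoint T
  refine ⟨E u, hE u, fun t ht => ?_⟩
  have h1 : E u t = u ⟨t, ht⟩ := IccExtend_of_mem _ _ ht
  rw [h1]
  exact (congrArg (fun f : C(Icc 0 η, ℝ) => f ⟨t, ht⟩) hfix).symm

theorem exists_singular_solution (k : ℕ) {H : ℝ × ℝ → ℝ} (hH : ContDiff ℝ ∞ H)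
    (hH0 : H (0, 0) = 0) (hd : HasDerivAt (fun y => H (0, y)) 0 0) :
    ∃ δ > 0, ∃ x : ℝ → ℝ, Continuous x ∧ x 0 = 0 ∧
      ∀ t ∈ Ioo 0 δ, HasDerivAt x ((H (t, x t) - (k + 1 : ℕ) * x t) / t) t := by
  obtain ⟨η, hη, hL⟩ := exists_lipschitz_snd_of_hasDerivAt_zero hH hd
  let c : ℝ → ℝ := fun y => projIcc (-η) η (by linarith) y
  have hcL : ∀ y z, |c y - c z| ≤ |y - z| := fun y z => by
    have := (LipschitzWith.projIcc (show -η ≤ η by linarith)).dist_le_mul y z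
    simpa [Subtype.dist_eq, Real.dist_eq] using this
  have hcm : ∀ y, c y ∈ Icc (-η) η := fun y => (projIcc (-η) η _ y).2
  have hce : ∀ y ∈ Icc (-η) η, c y = y := fun y hy => by
    simp only [c]; rw [projIcc_of_mem _ hy]
  have hKc : Continuous fun p : ℝ × ℝ => H (p.1, c p.2) := hH.continuous.comp (by fun_prop)
  obtain ⟨x, hx, hxe⟩ := exists_singular_integral_equation hKc hη (fun t ht y z =>
    (hL t ht _ (hcm y) _ (hcm z)).trans (by linarith [hcL y z])) k
  simp only at hxe
  have hc0 : c 0 = 0 := hce 0 ⟨by linarith, hη.le⟩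
  have hx0 : x 0 = 0 := by
    have h1 := hxe 0 ⟨le_rfl, hη.le⟩
    simp only [mul_zero, intervalIntegral.integral_mul_const, integral_pow, one_pow] at h1
    have h2 := hL 0 ⟨le_rfl, hη.le⟩ _ (hcm (x 0)) _ (hcm 0)
    rw [hc0, hH0, sub_zero, sub_zero] at h2
    have h3 := hcL (x 0) 0
    rw [hc0, sub_zero, sub_zero] at h3
    have h4 : |x 0| ≤ |H (0, c (x 0))| := by
      nth_rewrite 1 [h1]
      rw [abs_mul]
      refine mul_le_of_le_one_left (abs_nonneg _) ?_
      rw [abs_of_nonneg (by simp; positivity)]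
      rw [div_le_one (by positivity)]
      simp
    have h5 := abs_nonneg (x 0)
    exact abs_eq_zero.1 (by linarith)
  let h : ℝ → ℝ := fun r => H (r, c (x r))
  have hh : Continuous h := hH.continuous.comp (by fun_prop)
  let J : ℝ → ℝ := fun t => ∫ r in (0 : ℝ)..t, r ^ k * h r
  have hFc : Continuous fun r => r ^ k * h r := (continuous_pow k).mul hh
  have hJ : ∀ t, HasDerivAt J (t ^ k * h t) t := fun t =>
    intervalIntegral.integral_hasDerivAt_right (hFc.intervalIntegrable _ _)
      hFc.stronglyMeasurable.stronglyMeasurableAtFilter hFc.continuousAt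
  have hxJ : ∀ t ∈ Icc 0 η, t ^ (k + 1) * x t = J t := by
    intro t ht
    have h1 := intervalIntegral.mul_integral_comp_mul_left (a := 0) (b := 1)
      (f := fun r => r ^ k * h r) t
    rw [mul_zero, mul_one] at h1
    rw [show J t = _ from h1.symm, hxe t ht, pow_succ', mul_assoc,
      ← intervalIntegral.integral_const_mul]
    congr 1
    refine intervalIntegral.integral_congr fun s _ => ?_
    simp only [h, mul_comm s t, mul_pow]
    ring
  obtain ⟨δ, hδ, hδx⟩ := Metric.continuousAt_iff.1 (hx.continuousAt (x := 0)) η hη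
  refine ⟨min δ η, lt_min hδ hη, x, hx, hx0, fun t ht => ?_⟩
  have ht0 : t ≠ 0 := ht.1.ne'
  have htη : t < η := ht.2.trans_le (min_le_right _ _)
  have h1 := (hJ t).div (hasDerivAt_pow (k + 1) t) (pow_ne_zero _ ht0)
  have h2 : x =ᶠ[𝓝 t] fun t => J t / t ^ (k + 1) := by
    filter_upwards [Ioo_mem_nhds ht.1 htη] with r hr
    rw [← hxJ r (Ioo_subset_Icc_self hr), mul_div_cancel_left₀ _ (pow_ne_zero _ hr.1.ne')]
  have h3 : c (x t) = x t := by
    refine hce _ ?_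
    have : dist (x t) (x 0) < η := hδx (by
      rw [Real.dist_eq, sub_zero, abs_of_pos ht.1]; exact ht.2.trans_le (min_le_left _ _))
    rw [hx0, Real.dist_eq, sub_zero] at this
    exact abs_le.1 this.le
  refine (h1.congr_of_eventuallyEq h2).congr_deriv ?_
  rw [← hxJ t ⟨ht.1.le, htη.le⟩]
  simp only [h, h3]
  field_simp
  simp
  ring

theorem exists_smooth_singular_solution (k : ℕ) {G : ℝ × ℝ → ℝ} (hG : ContDiff ℝ ∞ G)
    (hG0 : G (0, 0) = 0) (hd : HasDerivAt (fun y => G (0, y)) (-(k + 1 : ℕ)) 0) :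
    ∃ δ > 0, ∃ x : ℝ → ℝ, x 0 = 0 ∧ ContDiffWithinAt ℝ ∞ x (Ici 0) 0 ∧
      ∀ t ∈ Ioo 0 δ, HasDerivAt x (G (t, x t) / t) t := by
  obtain ⟨δ, hδ, x, hxc, hx0, hx⟩ := exists_singular_solution k
    (H := fun p => G p + (k + 1 : ℕ) * p.2) (hG.add (contDiff_const.mul contDiff_snd))
    (by simp [hG0]) (by simpa using hd.fun_add ((hasDerivAt_id (0 : ℝ)).const_mul ((k + 1 : ℕ) : ℝ)))
  simp only [add_sub_cancel_right] at hx
  refine ⟨δ, hδ, x, hx0, contDiffWithinAt_infty.2 fun j => ?_, hx⟩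
  have hxt : Tendsto x (𝓝[>] 0) (𝓝 0) := by
    have := hxc.tendsto 0
    rw [hx0] at this
    exact this.mono_left nhdsWithin_le_nhds
  obtain ⟨ε, hε, h⟩ := exists_contDiffOn_nat_of_singular j hG hG0
    (l := (k + 1 : ℕ)) (by positivity) hd hδ hx0 hxt hx
  exact (h 0 ⟨le_rfl, hε⟩).mono_of_mem_nhdsWithin (Ico_mem_nhdsGE hε)

/-- The right-hand side of the equation `(y')² = f(t) (g(t) + m (σ y² - 2 y))`. -/
def radicand (f g : ℝ → ℝ) (m σ t y : ℝ) : ℝ := f t * (g t + m * (σ * y ^ 2 - 2 * y))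

theorem abs_sqrt_sub_sqrt_le {ε a b : ℝ} (hε : 0 < ε) (ha : ε ≤ a) (hb : ε ≤ b) :
    |√a - √b| ≤ (√ε)⁻¹ * |a - b| := by
  have h1 : √ε ≤ √a := Real.sqrt_le_sqrt ha
  have h2 := Real.sqrt_nonneg b
  have h3 : 0 < √ε := Real.sqrt_pos.2 hε
  have h4 : a - b = (√a - √b) * (√a + √b) := by
    have e1 := Real.sq_sqrt (hε.le.trans ha)
    have e2 := Real.sq_sqrt (hε.le.trans hb)
    nlinarith
  rw [h4, abs_mul, abs_of_nonneg (by linarith : 0 ≤ √a + √b), inv_mul_eq_div, le_div_iff₀ h3]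
  exact mul_le_mul_of_nonneg_left (by linarith) (abs_nonneg _)

theorem abs_radicand_sub_le {f g : ℝ → ℝ} {m σ t y z F B : ℝ} (hf : 0 ≤ f t) (hF : f t ≤ F)
    (hm : 0 ≤ m) (hσ : |σ| ≤ 1) (hy : |y| ≤ B) (hz : |z| ≤ B) :
    |radicand f g m σ t y - radicand f g m σ t z| ≤ F * (m * (2 * B + 2)) * |y - z| := by
  have h1 : radicand f g m σ t y - radicand f g m σ t z
      = f t * (m * (σ * (y + z) - 2)) * (y - z) := by
    simp only [radicand]; ring
  have h2 : |σ * (y + z) - 2| ≤ 2 * B + 2 := by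
    have h3 : |σ * (y + z)| ≤ 1 * (B + B) := by
      rw [abs_mul]
      exact mul_le_mul hσ ((abs_add_le _ _).trans (add_le_add hy hz)) (abs_nonneg _) zero_le_one
    have := abs_sub (σ * (y + z)) 2
    rw [abs_two] at this
    linarith
  have h3 : 0 ≤ F := hf.trans hF
  rw [h1, abs_mul, abs_mul, abs_mul, abs_of_nonneg hf, abs_of_nonneg hm]
  gcongr

theorem sqrt_radicand_unique {f g : ℝ → ℝ} {m σ t₀ T : ℝ} {y z : ℝ → ℝ}
    (hf : Continuous f) (hg : Continuous g) (hm : 0 ≤ m) (hσ : |σ| ≤ 1)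
    (hfpos : ∀ t ∈ Icc t₀ T, 0 < f t)
    (hy : ∀ t ∈ Icc t₀ T, 0 < radicand f g m σ t (y t) ∧
      HasDerivWithinAt y (√(radicand f g m σ t (y t))) (Icc t₀ T) t)
    (hz : ∀ t ∈ Icc t₀ T, 0 < radicand f g m σ t (z t) ∧
      HasDerivWithinAt z (√(radicand f g m σ t (z t))) (Icc t₀ T) t)
    (h0 : y t₀ = z t₀) : EqOn y z (Icc t₀ T) := by
  rcases lt_or_ge T t₀ with hT | hT
  · simp [Icc_eq_empty (not_le.2 hT)]
  have hbd : ∀ u : ℝ → ℝ, (∀ t ∈ Icc t₀ T, 0 < radicand f g m σ t (u t) ∧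
      HasDerivWithinAt u (√(radicand f g m σ t (u t))) (Icc t₀ T) t) →
      ContinuousOn u (Icc t₀ T) ∧ ∃ ε > 0, ∃ B, ∀ t ∈ Icc t₀ T,
        ε ≤ radicand f g m σ t (u t) ∧ |u t| ≤ B := by
    intro u hu
    have huc : ContinuousOn u (Icc t₀ T) := fun t ht => (hu t ht).2.continuousWithinAt
    have hRc : ContinuousOn (fun t => radicand f g m σ t (u t)) (Icc t₀ T) := by
      have := hf.continuousOn (s := Icc t₀ T)
      have := hg.continuousOn (s := Icc t₀ T)
      unfold radicand
      fun_prop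
    obtain ⟨s, hs, hmin⟩ := isCompact_Icc.exists_isMinOn ⟨t₀, le_rfl, hT⟩ hRc
    obtain ⟨B, hB⟩ := isCompact_Icc.exists_bound_of_continuousOn huc
    exact ⟨huc, _, (hu s hs).1, B, fun t ht => ⟨hmin ht, hB t ht⟩⟩
  obtain ⟨hyc, ε₁, hε₁, B₁, h₁⟩ := hbd y hy
  obtain ⟨hzc, ε₂, hε₂, B₂, h₂⟩ := hbd z hz
  obtain ⟨F, hF⟩ := isCompact_Icc.exists_bound_of_continuousOn (hf.continuousOn (s := Icc t₀ T))
  have hε : 0 < min ε₁ ε₂ := lt_min hε₁ hε₂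
  have hici : ∀ u : ℝ → ℝ, ∀ u' : ℝ, ∀ t ∈ Ico t₀ T, HasDerivWithinAt u u' (Icc t₀ T) t →
      HasDerivWithinAt u u' (Ici t) t := fun u u' t ht h =>
    h.mono_of_mem_nhdsWithin (mem_of_superset (Icc_mem_nhdsGE ht.2) (Icc_subset_Icc_left ht.1))
  refine ODE_solution_unique_of_mem_Icc_right (v := fun t y => √(radicand f g m σ t y))
    (s := fun t => {y | min ε₁ ε₂ ≤ radicand f g m σ t y ∧ |y| ≤ max B₁ B₂})
    (K := Real.toNNReal ((√(min ε₁ ε₂))⁻¹ * (F * (m * (2 * max B₁ B₂ + 2)))))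
    ?_ hyc (fun t ht => hici _ _ t ht (hy t (Ico_subset_Icc_self ht)).2)
    (fun t ht => ?_) hzc (fun t ht => hici _ _ t ht (hz t (Ico_subset_Icc_self ht)).2)
    (fun t ht => ?_) h0
  · intro t ht
    have ht := Ico_subset_Icc_self ht
    refine LipschitzOnWith.of_dist_le_mul fun a ha b hb => ?_
    have hFt : f t ≤ F := (le_abs_self _).trans (hF t ht)
    have hB0 : 0 ≤ max B₁ B₂ := (abs_nonneg _).trans ha.2
    rw [Real.coe_toNNReal _ (by have := (hfpos t ht).le.trans hFt; positivity), mul_assoc]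
    refine (abs_sqrt_sub_sqrt_le hε ha.1 hb.1).trans ?_
    exact mul_le_mul_of_nonneg_left
      (abs_radicand_sub_le (hfpos t ht).le hFt hm hσ ha.2 hb.2) (by positivity)
  · have := h₁ t (Ico_subset_Icc_self ht)
    exact ⟨(min_le_left _ _).trans this.1, this.2.trans (le_max_left _ _)⟩
  · have := h₂ t (Ico_subset_Icc_self ht)
    exact ⟨(min_le_right _ _).trans this.1, this.2.trans (le_max_right _ _)⟩

/-- A solution of the equation whose right-hand side is truncated between `ε` and `M`. -/
theorem exists_truncated_solution {f g : ℝ → ℝ} {m σ t₀ T ε M : ℝ} (hf : Continuous f)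
    (hg : Continuous g) (hm : 0 ≤ m) (hσ : |σ| ≤ 1) (hT : t₀ ≤ T)
    (hfpos : ∀ t ∈ Icc t₀ T, 0 < f t) (hε : 0 < ε) (hεM : ε ≤ M) (y₀ : ℝ) :
    ∃ y : ℝ → ℝ, y t₀ = y₀ ∧ ∀ t ∈ Icc t₀ T,
      HasDerivWithinAt y (√(max ε (min (radicand f g m σ t (y t)) M))) (Icc t₀ T) t := by
  obtain ⟨F, hF⟩ := isCompact_Icc.exists_bound_of_continuousOn (hf.continuousOn (s := Icc t₀ T))
  have hF0 : 0 ≤ F := (norm_nonneg _).trans (hF t₀ ⟨le_rfl, hT⟩)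
  let a : NNReal := ⟨√M * (T - t₀), mul_nonneg (Real.sqrt_nonneg _) (by linarith)⟩
  have hPL : IsPicardLindelof (fun t y => √(max ε (min (radicand f g m σ t y) M)))
      (⟨t₀, le_rfl, hT⟩ : Icc t₀ T) y₀ a 0 ⟨√M, Real.sqrt_nonneg _⟩
      (Real.toNNReal ((√ε)⁻¹ * (F * (m * (2 * (|y₀| + a) + 2))))) := by
    refine ⟨fun t ht => LipschitzOnWith.of_dist_le_mul fun y hy z hz => ?_, fun y _ => ?_,
      fun t _ y _ => ?_, ?_⟩
    · have hB : ∀ y ∈ Metric.closedBall y₀ (a : ℝ), |y| ≤ |y₀| + a := fun y hy => by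
        have h1 : |y - y₀| ≤ a := hy
        have h2 := abs_add_le (y - y₀) y₀
        rw [sub_add_cancel] at h2
        linarith
      rw [Real.coe_toNNReal _ (by positivity), mul_assoc]
      refine (abs_sqrt_sub_sqrt_le hε (le_max_left _ _) (le_max_left _ _)).trans ?_
      refine mul_le_mul_of_nonneg_left ?_ (by positivity)
      refine le_trans ?_ (abs_radicand_sub_le (g := g) (hfpos t ht).le
        ((le_abs_self _).trans (hF t ht)) hm hσ (hB y hy) (hB z hz))
      refine (abs_max_sub_max_le_max _ _ _ _).trans ?_
      rw [sub_self, abs_zero, max_eq_right (abs_nonneg _)]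
      refine (abs_min_sub_min_le_max _ _ _ _).trans ?_
      rw [sub_self, abs_zero, max_eq_left (abs_nonneg _)]
    · unfold radicand
      fun_prop
    · rw [Real.norm_eq_abs, abs_of_nonneg (Real.sqrt_nonneg _)]
      exact Real.sqrt_le_sqrt (max_le hεM (min_le_right _ _))
    · change √M * max (T - t₀) (t₀ - t₀) ≤ √M * (T - t₀) - 0
      rw [sub_self, max_eq_left (by linarith), sub_zero]
  exact hPL.exists_eq_forall_mem_Icc_hasDerivWithinAt₀

theorem exists_sqrt_radicand_solution_Icc {f g g' : ℝ → ℝ} {m σ t₀ T y₀ : ℝ} (hf : Continuous f)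
    (hg : ∀ t, HasDerivAt g (g' t) t) (hg' : Continuous g') (hm : 0 ≤ m) (hσ : |σ| ≤ 1)
    (hT : t₀ ≤ T) (hfpos : ∀ t ∈ Icc t₀ T, 0 < f t) (hg'pos : ∀ t ∈ Icc t₀ T, 0 < g' t)
    (hy₀ : 0 ≤ y₀) (h0 : 0 < radicand f g m σ t₀ y₀) :
    ∃ y : ℝ → ℝ, y t₀ = y₀ ∧ ∀ t ∈ Icc t₀ T, 0 < radicand f g m σ t (y t) ∧
      HasDerivWithinAt y (√(radicand f g m σ t (y t))) (Icc t₀ T) t := by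
  have ht₀ : t₀ ∈ Icc t₀ T := ⟨le_rfl, hT⟩
  have hgc : Continuous g := continuous_iff_continuousAt.2 fun t => (hg t).continuousAt
  obtain ⟨F, hF⟩ := isCompact_Icc.exists_bound_of_continuousOn (hf.continuousOn (s := Icc t₀ T))
  obtain ⟨Γ, hΓ⟩ := isCompact_Icc.exists_bound_of_continuousOn (hgc.continuousOn (s := Icc t₀ T))
  obtain ⟨s₁, hs₁, hmin₁⟩ := isCompact_Icc.exists_isMinOn ⟨t₀, ht₀⟩ (hf.continuousOn (s := Icc t₀ T))
  obtain ⟨s₂, hs₂, hmin₂⟩ := isCompact_Icc.exists_isMinOn ⟨t₀, ht₀⟩ (hg'.continuousOn (s := Icc t₀ T))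
  have hF0 : 0 < F := (hfpos t₀ ht₀).trans_le ((le_abs_self _).trans (hF t₀ ht₀))
  have hΓ0 : 0 ≤ Γ := (norm_nonneg _).trans (hΓ t₀ ht₀)
  set L := F * (Γ + m) + 1 with hL
  have hL1 : 1 ≤ L := by
    have : 0 ≤ F * (Γ + m) := by positivity
    linarith
  -- the bound `W` on the solution and the upper truncation level
  set W := (1 + y₀) * Real.exp ((L + 1) * (T - t₀))
  have hW0 : 0 ≤ W := by positivity
  set M := L ^ 2 * (1 + W) ^ 2 with hM
  have hRle : ∀ t ∈ Icc t₀ T, ∀ y, 0 ≤ y → radicand f g m σ t y ≤ L ^ 2 * (1 + y) ^ 2 := by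
    intro t ht y hy
    have h1 : g t + m * (σ * y ^ 2 - 2 * y) ≤ (Γ + m) * (1 + y) ^ 2 := by
      have := (le_abs_self _).trans (hΓ t ht)
      have := (abs_le.1 hσ).2
      have e1 : σ * y ^ 2 ≤ 1 * y ^ 2 := by gcongr
      nlinarith [mul_nonneg hΓ0 (by positivity : 0 ≤ 2 * y + y ^ 2)]
    have h2 : f t ≤ F := (le_abs_self _).trans (hF t ht)
    have h3 : 0 ≤ (Γ + m) * (1 + y) ^ 2 := by positivity
    calc radicand f g m σ t y ≤ f t * ((Γ + m) * (1 + y) ^ 2) :=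
          mul_le_mul_of_nonneg_left h1 (hfpos t ht).le
      _ ≤ F * ((Γ + m) * (1 + y) ^ 2) := mul_le_mul_of_nonneg_right h2 h3
      _ ≤ L * (1 + y) ^ 2 := by rw [← mul_assoc]; gcongr; linarith
      _ ≤ L ^ 2 * (1 + y) ^ 2 := by gcongr; nlinarith
  -- the threshold `e` below which `g + m (σ y² - 2 y)` must increase
  obtain ⟨e, he, he0, heF, heμ⟩ : ∃ e > 0, e ≤ g t₀ + m * (σ * y₀ ^ 2 - 2 * y₀) ∧ F * e ≤ 1 ∧
      m * (2 * W + 2) * √(F * e) < g' s₂ := by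
    have hE0 : 0 < g t₀ + m * (σ * y₀ ^ 2 - 2 * y₀) := (mul_pos_iff_of_pos_left (hfpos t₀ ht₀)).1 h0
    have c1 : Tendsto (fun e : ℝ => F * e) (𝓝[>] 0) (𝓝 (F * 0)) :=
      (tendsto_id.const_mul F).mono_left nhdsWithin_le_nhds
    have c2 : Tendsto (fun e : ℝ => m * (2 * W + 2) * √(F * e)) (𝓝[>] 0) (𝓝 0) := by
      simpa using (c1.sqrt).const_mul (m * (2 * W + 2))
    obtain ⟨e, h1, h2, h3⟩ := (Filter.Eventually.and (Ioo_mem_nhdsGT hE0)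
      ((c1.eventually_lt_const (by simp : F * 0 < 1)).and
        (c2.eventually_lt_const (hg'pos s₂ hs₂)))).exists
    exact ⟨e, h1.1, h1.2.le, h2.le, h3⟩
  set ε := f s₁ * e
  have hε0 : 0 < ε := mul_pos (hfpos s₁ hs₁) he
  have hεF : ε ≤ F * e := mul_le_mul_of_nonneg_right ((le_abs_self _).trans (hF s₁ hs₁)) he.le
  have hε1 : ε ≤ 1 := hεF.trans heF
  have hLM : ∀ y, 0 ≤ y → 1 ≤ L ^ 2 * (1 + y) ^ 2 := fun y hy => by
    have h1 : 1 ≤ L ^ 2 := one_le_pow₀ hL1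
    have h2 : 1 ≤ (1 + y) ^ 2 := one_le_pow₀ (by linarith)
    nlinarith
  obtain ⟨y, hyt₀, hy⟩ := exists_truncated_solution hf hgc hm hσ hT hfpos hε0
    (hε1.trans (hLM W hW0)) y₀ (M := M)
  have hyc : ContinuousOn y (Icc t₀ T) := fun t ht => (hy t ht).continuousWithinAt
  have hici : ∀ t ∈ Ico t₀ T, HasDerivWithinAt y
      (√(max ε (min (radicand f g m σ t (y t)) M))) (Ici t) t := fun t ht =>
    (hy t (Ico_subset_Icc_self ht)).mono_of_mem_nhdsWithin
      (mem_of_superset (Icc_mem_nhdsGE ht.2) (Icc_subset_Icc_left ht.1))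
  have hynn : ∀ t ∈ Icc t₀ T, 0 ≤ y t := by
    have hmono : MonotoneOn y (Icc t₀ T) := by
      refine monotoneOn_of_hasDerivWithinAt_nonneg (convex_Icc _ _) hyc
        (f' := fun t => √(max ε (min (radicand f g m σ t (y t)) M))) (fun t ht => ?_)
        fun t _ => Real.sqrt_nonneg _
      exact (hy t (interior_subset ht)).mono interior_subset
    intro t ht
    have := hmono ht₀ ht ht.1
    linarith
  have hyW : ∀ t ∈ Icc t₀ T, y t ≤ W := by
    intro t ht
    have hB : ∀ x, HasDerivAt (fun r => (1 + y₀) * Real.exp ((L + 1) * (r - t₀)) - 1)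
        ((L + 1) * ((1 + y₀) * Real.exp ((L + 1) * (x - t₀)))) x := fun x => by
      have := (((((hasDerivAt_id x).sub_const t₀).const_mul (L + 1)).exp).const_mul
        (1 + y₀)).sub_const 1
      refine this.congr_deriv ?_
      simp only [id]; ring
    have h1 := image_le_of_deriv_right_lt_deriv_boundary' hyc hici (by simp [hyt₀])
      (fun r _ => (hB r).continuousAt.continuousWithinAt) (fun r _ => (hB r).hasDerivWithinAt)
      (fun r hr hre => by
        have hr := Ico_subset_Icc_self hr
        have hnn := hynn r hr
        have h2 : √(max ε (min (radicand f g m σ r (y r)) M)) ≤ L * (1 + y r) := by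
          rw [← Real.sqrt_sq (by positivity : 0 ≤ L * (1 + y r)), mul_pow]
          exact Real.sqrt_le_sqrt (max_le (hε1.trans (hLM _ hnn))
            ((min_le_left _ _).trans (hRle r hr _ hnn)))
        have h3 : (1 + y₀) * Real.exp ((L + 1) * (r - t₀)) = 1 + y r := by linarith
        rw [h3]
        linarith) ht
    have h2 : Real.exp ((L + 1) * (t - t₀)) ≤ Real.exp ((L + 1) * (T - t₀)) := by
      have := ht.2
      gcongr
    have h3 := mul_le_mul_of_nonneg_left h2 (by linarith : 0 ≤ 1 + y₀)
    linarith
  have hyM : ∀ t ∈ Icc t₀ T, radicand f g m σ t (y t) ≤ M := fun t ht => by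
    have h1 := hynn t ht
    refine (hRle t ht _ h1).trans ?_
    rw [hM]
    have := hyW t ht
    gcongr
  have hE : ∀ t ∈ Icc t₀ T, e ≤ g t + m * (σ * y t ^ 2 - 2 * y t) := by
    intro t ht
    have h1 := image_le_of_deriv_right_lt_deriv_boundary'
      (f := fun t => -(g t + m * (σ * y t ^ 2 - 2 * y t)))
      (f' := fun t => -(g' t + m * (σ * (2 * y t) - 2) *
        √(max ε (min (radicand f g m σ t (y t)) M))))
      (a := t₀) (b := T) (B := fun _ => -e) (B' := fun _ => 0) ?_ ?_ ?_ continuousOn_const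
      (fun _ _ => hasDerivWithinAt_const _ _ _) ?_ ht
    · exact neg_le_neg_iff.1 h1
    · have := hgc.continuousOn (s := Icc t₀ T)
      fun_prop
    · intro r hr
      have d := hici r hr
      have := ((hg r).hasDerivWithinAt (s := Ici r)).fun_add
        ((((d.fun_pow 2).const_mul σ).fun_sub (d.const_mul 2)).const_mul m)
      refine this.fun_neg.congr_deriv ?_
      simp only [Nat.cast_ofNat, Nat.add_one_sub_one, pow_one]
      ring
    · simpa [hyt₀] using he0
    · intro r hr hre
      have hr := Ico_subset_Icc_self hr
      have hEr : g r + m * (σ * y r ^ 2 - 2 * y r) = e := neg_injective hre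
      have h2 : √(max ε (min (radicand f g m σ r (y r)) M)) ≤ √(F * e) := by
        refine Real.sqrt_le_sqrt (max_le hεF ((min_le_left _ _).trans ?_))
        rw [radicand, hEr]
        exact mul_le_mul_of_nonneg_right ((le_abs_self _).trans (hF r hr)) he.le
      have h3 : -(2 * W + 2) ≤ σ * (2 * y r) - 2 := by
        have a1 := (abs_le.1 hσ).1
        have a2 := hynn r hr
        have a3 := hyW r hr
        nlinarith
      have h4 : g' s₂ ≤ g' r := hmin₂ hr
      have h5 := Real.sqrt_nonneg (max ε (min (radicand f g m σ r (y r)) M))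
      have h6 : -(m * (2 * W + 2) * √(F * e)) ≤ m * (σ * (2 * y r) - 2) *
          √(max ε (min (radicand f g m σ r (y r)) M)) := by
        have b1 : m * (-(2 * W + 2)) ≤ m * (σ * (2 * y r) - 2) := mul_le_mul_of_nonneg_left h3 hm
        have b2 := mul_le_mul_of_nonneg_right b1 h5
        have b3 := mul_le_mul_of_nonneg_left h2 (by positivity : 0 ≤ m * (2 * W + 2))
        linarith
      linarith
  refine ⟨y, hyt₀, fun t ht => ?_⟩
  have hRε : ε ≤ radicand f g m σ t (y t) :=
    mul_le_mul (hmin₁ ht) (hE t ht) he.le (hfpos t ht).le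
  refine ⟨hε0.trans_le hRε, ?_⟩
  have := hy t ht
  rwa [min_eq_left (hyM t ht), max_eq_right hRε] at this

theorem exists_sqrt_radicand_solution_Ici {f g g' : ℝ → ℝ} {m σ t₀ y₀ : ℝ} (hf : Continuous f)
    (hg : ∀ t, HasDerivAt g (g' t) t) (hg' : Continuous g') (hm : 0 ≤ m) (hσ : |σ| ≤ 1)
    (hfpos : ∀ t, t₀ ≤ t → 0 < f t) (hg'pos : ∀ t, t₀ ≤ t → 0 < g' t)
    (hy₀ : 0 ≤ y₀) (h0 : 0 < radicand f g m σ t₀ y₀) :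
    ∃ y : ℝ → ℝ, y t₀ = y₀ ∧ ∀ t, t₀ ≤ t → 0 < radicand f g m σ t (y t) ∧
      HasDerivWithinAt y (√(radicand f g m σ t (y t))) (Ici t₀) t := by
  have hgc : Continuous g := continuous_iff_continuousAt.2 fun t => (hg t).continuousAt
  choose Y hY0 hY using fun k : ℕ => exists_sqrt_radicand_solution_Icc (T := t₀ + k + 1) hf hg hg' hm
    hσ (by linarith [(Nat.cast_nonneg k : (0 : ℝ) ≤ k)]) (fun t ht => hfpos t ht.1)
    (fun t ht => hg'pos t ht.1) hy₀ h0
  have hle : ∀ j k : ℕ, j ≤ k → EqOn (Y j) (Y k) (Icc t₀ (t₀ + j + 1)) := fun j k hjk => by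
    have hc : (j : ℝ) ≤ k := by exact_mod_cast hjk
    have hsub : Icc t₀ (t₀ + j + 1) ⊆ Icc t₀ (t₀ + k + 1) := Icc_subset_Icc_right (by linarith)
    exact sqrt_radicand_unique hf hgc hm hσ (fun t ht => hfpos t ht.1) (hY j)
      (fun t ht => ⟨(hY k t (hsub ht)).1, (hY k t (hsub ht)).2.mono hsub⟩)
      ((hY0 j).trans (hY0 k).symm)
  have heq : ∀ j k : ℕ, ∀ t ∈ Icc t₀ (t₀ + j + 1), t ∈ Icc t₀ (t₀ + k + 1) → Y j t = Y k t := by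
    intro j k t hj hk
    rcases le_total j k with h | h
    · exact hle j k h hj
    · exact (hle k j h hk).symm
  have hceil : ∀ t, t₀ ≤ t → t ∈ Ico t₀ (t₀ + ⌈t - t₀⌉₊ + 1) := fun t ht =>
    ⟨ht, by linarith [Nat.le_ceil (t - t₀)]⟩
  refine ⟨fun t => Y ⌈t - t₀⌉₊ t, hY0 _, fun t ht => ?_⟩
  have h1 := hceil t ht
  obtain ⟨h2, h3⟩ := hY _ t (Ico_subset_Icc_self h1)
  refine ⟨h2, ?_⟩
  have h4 : Icc t₀ (t₀ + ⌈t - t₀⌉₊ + 1) ∈ 𝓝[Ici t₀] t := by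
    rw [← Ici_inter_Iic]
    exact inter_mem_nhdsWithin _ (Iic_mem_nhds h1.2)
  refine (h3.mono_of_mem_nhdsWithin h4).congr_of_eventuallyEq ?_ rfl
  filter_upwards [h4] with r hr
  exact heq _ _ r (Ico_subset_Icc_self (hceil r hr.1)) hr

theorem contDiffOn_of_sqrt_radicand {f g y : ℝ → ℝ} {m σ : ℝ} {s : Set ℝ} (hs : IsOpen s)
    (hf : ContDiff ℝ ∞ f) (hg : ContDiff ℝ ∞ g)
    (hy : ∀ t ∈ s, 0 < radicand f g m σ t (y t) ∧ HasDerivAt y (√(radicand f g m σ t (y t))) t) :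
    ContDiffOn ℝ ∞ y s := by
  refine contDiffOn_infty.2 fun k => ?_
  induction k with
  | zero => exact contDiffOn_zero.2 fun t ht => (hy t ht).2.continuousAt.continuousWithinAt
  | succ k ih =>
    refine contDiffOn_succ_of_hasDerivWithinAt hs.uniqueDiffOn
      (fun t ht => (hy t ht).2.hasDerivWithinAt) (ContDiffOn.sqrt ?_ fun t ht => (hy t ht).1.ne')
    have hf := (hf.of_le (by exact_mod_cast le_top : (k : WithTop ℕ∞) ≤ ∞)).contDiffOn (s := s)
    have hg := (hg.of_le (by exact_mod_cast le_top : (k : WithTop ℕ∞) ≤ ∞)).contDiffOn (s := s)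
    unfold radicand
    fun_prop

theorem exists_contDiff_eq_sqrt {b : ℝ} (hb : 0 < b) :
    ∃ S : ℝ → ℝ, ContDiff ℝ ∞ S ∧ ∀ r, b ≤ r → S r = √r := by
  have hc : ContDiff ℝ ∞ fun r : ℝ => Real.smoothTransition (2 / b * r - 1) :=
    Real.smoothTransition.contDiff.comp (by fun_prop)
  refine ⟨fun r => Real.smoothTransition (2 / b * r - 1) * √r, ?_, fun r hr => ?_⟩
  · refine contDiff_iff_contDiffAt.2 fun r => ?_
    by_cases hr : r = 0
    · have : (fun r => Real.smoothTransition (2 / b * r - 1) * √r) =ᶠ[𝓝 r] fun _ => 0 := by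
        filter_upwards [Iio_mem_nhds (show r < b / 2 by rw [hr]; positivity)] with q hq
        rw [Real.smoothTransition.zero_of_nonpos, zero_mul]
        have h1 : 2 / b * q ≤ 2 / b * (b / 2) :=
          mul_le_mul_of_nonneg_left (mem_Iio.1 hq).le (by positivity)
        have h2 : 2 / b * (b / 2) = 1 := by field_simp
        linarith
      exact contDiffAt_const.congr_of_eventuallyEq this
    · exact hc.contDiffAt.mul (contDiffAt_id.sqrt hr)
  · have h1 : 2 / b * b ≤ 2 / b * r := mul_le_mul_of_nonneg_left hr (by positivity)
    have h2 : 2 / b * b = 2 := by field_simp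
    simp only []
    rw [Real.smoothTransition.one_of_one_le (by linarith), one_mul]

/-- The radicand after the substitution `y = t² u`, divided by `t²`. -/
def blowupRadicand (f ψ : ℝ → ℝ) (m σ t u : ℝ) : ℝ := f t * (m * (σ * t ^ 2 * u ^ 2 - 2 * u) + ψ t)

theorem exists_smooth_solution_near_zero (k : ℕ) {f ψ : ℝ → ℝ} {m σ a : ℝ}
    (hf : ContDiff ℝ ∞ f) (hψ : ContDiff ℝ ∞ ψ) (ha : 0 < a) (hm : m = k + 1)
    (hf0 : f 0 = 2 * a) (hψ0 : ψ 0 = 2 * a * (m + 1)) :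
    ∃ δ > 0, ∃ y : ℝ → ℝ, y 0 = 0 ∧ ContDiffWithinAt ℝ ∞ y (Ici 0) 0 ∧
      HasDerivWithinAt y 0 (Ici 0) 0 ∧ ∀ t ∈ Ioo 0 δ, 0 < y t ∧
        0 < radicand f (fun s => s ^ 2 * ψ s) m σ t (y t) ∧
        HasDerivAt y (√(radicand f (fun s => s ^ 2 * ψ s) m σ t (y t))) t := by
  obtain ⟨S, hS, hSe⟩ := exists_contDiff_eq_sqrt (b := 2 * a ^ 2) (by positivity)
  set Q : ℝ × ℝ → ℝ := fun p => blowupRadicand f ψ m σ p.1 (a + p.2) with hQ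
  have hQs : ContDiff ℝ ∞ Q := by
    have h1 : ContDiff ℝ ∞ fun p : ℝ × ℝ => f p.1 := hf.comp contDiff_fst
    have h2 : ContDiff ℝ ∞ fun p : ℝ × ℝ => ψ p.1 := hψ.comp contDiff_fst
    simp only [hQ, blowupRadicand]
    fun_prop
  have hQ0 : ∀ x, Q (0, x) = (2 * a) ^ 2 - 4 * a * m * x := fun x => by
    simp only [hQ, blowupRadicand, hf0, hψ0]; ring
  set G : ℝ × ℝ → ℝ := fun p => S (Q p) - 2 * (a + p.2) with hG
  have hGs : ContDiff ℝ ∞ G := (hS.comp hQs).sub (by fun_prop)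
  have hQ00 : Q (0, 0) = (2 * a) ^ 2 := by rw [hQ0]; ring
  have hlt : 2 * a ^ 2 < (2 * a) ^ 2 := by nlinarith
  have hG0 : G (0, 0) = 0 := by
    simp only [hG, hQ00]
    rw [hSe _ hlt.le, Real.sqrt_sq (by positivity)]
    ring
  have hGd : HasDerivAt (fun x => G (0, x)) (-((k + 2) + 1 : ℕ)) 0 := by
    have h1 : HasDerivAt (fun x => Q (0, x)) (-(4 * a * m)) 0 := by
      simp only [hQ0]
      simpa using ((hasDerivAt_id (0 : ℝ)).const_mul (4 * a * m)).const_sub ((2 * a) ^ 2)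
    have h2 := (h1.sqrt (by rw [hQ00]; positivity)).fun_sub
      (((hasDerivAt_id (0 : ℝ)).const_add a).const_mul 2)
    have h3 : (fun x => G (0, x)) =ᶠ[𝓝 0] fun x => √(Q (0, x)) - 2 * (a + id x) := by
      have : ∀ᶠ x in 𝓝 0, 2 * a ^ 2 < Q (0, x) :=
        h1.continuousAt.eventually_const_lt (by simp only [hQ00]; exact hlt)
      filter_upwards [this] with x hx
      simp only [hG, id, hSe _ hx.le]
    refine (h2.congr_of_eventuallyEq h3).congr_deriv ?_
    rw [hQ00, Real.sqrt_sq (by positivity), hm]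
    push_cast
    field_simp
    ring
  obtain ⟨δ, hδ, x, hx0, hxs, hx⟩ := exists_smooth_singular_solution (k + 2) hGs hG0 hGd
  have hxt : Tendsto x (𝓝[>] 0) (𝓝 0) := by
    have : Tendsto x (𝓝[≥] 0) (𝓝 (x 0)) := hxs.continuousWithinAt
    rw [hx0] at this
    exact this.mono_left (nhdsWithin_mono _ Ioi_subset_Ici_self)
  have hid : Tendsto (fun t : ℝ => t) (𝓝[>] 0) (𝓝 0) := tendsto_id.mono_left nhdsWithin_le_nhds
  have hQt : Tendsto (fun t => Q (t, x t)) (𝓝[>] 0) (𝓝 (Q (0, 0))) :=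
    (hQs.continuous.tendsto (0, 0)).comp (hid.prodMk_nhds hxt)
  obtain ⟨δ', hδ', hd⟩ := (mem_nhdsGT_iff_exists_Ioo_subset).1
    (((hxt.eventually_const_lt (by linarith : -a < 0)).and
      (hQt.eventually_const_lt (by rw [hQ00]; exact hlt : 2 * a ^ 2 < Q (0, 0)))).and
      (Ioo_mem_nhdsGT hδ : ∀ᶠ t in 𝓝[>] (0 : ℝ), t ∈ Ioo 0 δ))
  have hys : ContDiffWithinAt ℝ ∞ (fun t => t ^ 2 * (a + x t)) (Ici 0) 0 := by fun_prop
  refine ⟨δ', hδ', fun t => t ^ 2 * (a + x t), by simp, hys, ?_, fun t ht => ?_⟩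
  · have h1 := (hxs.differentiableWithinAt (by simp)).hasDerivWithinAt
    have h2 := ((hasDerivAt_pow 2 (0 : ℝ)).hasDerivWithinAt (s := Ici 0)).fun_mul (h1.const_add a)
    simpa using h2
  · obtain ⟨⟨h1, h2⟩, h3⟩ := hd ht
    have h1 : -a < x t := h1
    have h2 : 2 * a ^ 2 < Q (t, x t) := h2
    have ht0 := ht.1
    have hQp : 0 < Q (t, x t) := lt_trans (by positivity) h2
    have hR : radicand f (fun s => s ^ 2 * ψ s) m σ t (t ^ 2 * (a + x t)) = t ^ 2 * Q (t, x t) := by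
      simp only [radicand, hQ, blowupRadicand]; ring
    refine ⟨mul_pos (by positivity) (by linarith), by rw [hR]; positivity, ?_⟩
    rw [hR, Real.sqrt_mul (by positivity), Real.sqrt_sq ht0.le, ← hSe _ h2.le]
    have h4 := (hasDerivAt_pow 2 t).fun_mul ((hx t h3).const_add a)
    refine h4.congr_deriv ?_
    simp only [hG]
    have := ht0.ne'
    field_simp
    push_cast
    ring

theorem exists_smooth_solution (k : ℕ) {f ψ : ℝ → ℝ} {m σ a : ℝ}
    (hf : ContDiff ℝ ∞ f) (hψ : ContDiff ℝ ∞ ψ) (ha : 0 < a) (hm : m = k + 1)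
    (hf0 : f 0 = 2 * a) (hψ0 : ψ 0 = 2 * a * (m + 1)) (hσ : |σ| ≤ 1)
    (hfpos : ∀ t, 0 ≤ t → 0 < f t) (hderiv : ∀ t, 0 < t → 0 < deriv (fun s => s ^ 2 * ψ s) t) :
    ∃ y : ℝ → ℝ, ContDiffOn ℝ ∞ y (Ici 0) ∧ y 0 = 0 ∧ HasDerivWithinAt y 0 (Ici 0) 0 ∧
      ∀ t, 0 < t → 0 < radicand f (fun s => s ^ 2 * ψ s) m σ t (y t) ∧
        HasDerivAt y (√(radicand f (fun s => s ^ 2 * ψ s) m σ t (y t))) t := by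
  obtain ⟨δ, hδ, y₁, hy₁0, hy₁s, hy₁d, hy₁⟩ :=
    exists_smooth_solution_near_zero k (σ := σ) hf hψ ha hm hf0 hψ0
  set g : ℝ → ℝ := fun s => s ^ 2 * ψ s
  have hg : ContDiff ℝ ∞ g := by fun_prop
  have ht₀ : 0 < δ / 2 := by positivity
  have ht₀δ : δ / 2 < δ := by linarith
  set t₀ := δ / 2
  obtain ⟨y₂, hy₂0, hy₂⟩ := exists_sqrt_radicand_solution_Ici (g := g) (g' := deriv g) (m := m)
    (σ := σ) (t₀ := t₀) (y₀ := y₁ t₀) hf.continuous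
    (fun t => (hg.differentiable (by simp) t).hasDerivAt) (hg.continuous_deriv (by simp))
    (by rw [hm]; positivity) hσ (fun t ht => hfpos t (ht₀.le.trans ht))
    (fun t ht => hderiv t (ht₀.trans_le ht)) (hy₁ t₀ ⟨ht₀, ht₀δ⟩).1.le (hy₁ t₀ ⟨ht₀, ht₀δ⟩).2.1
  set y : ℝ → ℝ := fun t => if t ≤ t₀ then y₁ t else y₂ t
  have hle : ∀ t, t ≤ t₀ → y t = y₁ t := fun t ht => if_pos ht
  have hge : ∀ t, t₀ ≤ t → y t = y₂ t := fun t ht => by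
    rcases ht.eq_or_lt with rfl | h
    · rw [hle _ le_rfl, hy₂0]
    · exact if_neg (not_le.2 h)
  have hyd : ∀ t, 0 < t → 0 < radicand f g m σ t (y t) ∧
      HasDerivAt y (√(radicand f g m σ t (y t))) t := by
    intro t ht
    rcases lt_trichotomy t t₀ with h | h | h
    · obtain ⟨-, h1, h2⟩ := hy₁ t ⟨ht, h.trans ht₀δ⟩
      rw [hle t h.le]
      exact ⟨h1, h2.congr_of_eventuallyEq (eventually_of_mem (Iic_mem_nhds h) hle)⟩
    · subst h
      obtain ⟨-, h1, h2⟩ := hy₁ t₀ ⟨ht, ht₀δ⟩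
      rw [hle t₀ le_rfl]
      refine ⟨h1, ?_⟩
      obtain ⟨-, h4⟩ := hy₂ t₀ le_rfl
      rw [hy₂0] at h4
      have h5 := (h2.hasDerivWithinAt (s := Iic t₀)).congr hle (hle t₀ le_rfl)
      have h6 := h4.congr hge (hge t₀ le_rfl)
      have h7 := h5.union h6
      rwa [Iic_union_Ici, hasDerivWithinAt_univ] at h7
    · obtain ⟨h1, h2⟩ := hy₂ t h.le
      rw [hge t h.le]
      exact ⟨h1, (h2.hasDerivAt (Ici_mem_nhds h)).congr_of_eventuallyEq
        (eventually_of_mem (Ici_mem_nhds h) hge)⟩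
  have hy0 : y 0 = y₁ 0 := hle 0 ht₀.le
  have hev : y =ᶠ[𝓝[≥] 0] y₁ :=
    eventually_of_mem (mem_nhdsWithin_of_mem_nhds (Iic_mem_nhds ht₀)) hle
  refine ⟨y, fun t ht => ?_, hy0.trans hy₁0, hy₁d.congr_of_eventuallyEq hev hy0, hyd⟩
  rcases (mem_Ici.1 ht).eq_or_lt with rfl | h
  · exact hy₁s.congr_of_eventuallyEq hev hy0
  · exact ((contDiffOn_of_sqrt_radicand isOpen_Ioi hf hg fun t ht => hyd t ht).contDiffAt
      (Ioi_mem_nhds h)).contDiffWithinAt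

theorem pos_of_continuousOn_Ici_of_ne_zero {f : ℝ → ℝ} (hf : ContinuousOn f (Ici 0))
    (hne : ∀ t, 0 ≤ t → f t ≠ 0) (h0 : 0 < f 0) {t : ℝ} (ht : 0 ≤ t) : 0 < f t := by
  by_contra! h
  obtain ⟨x, hx, hx0⟩ := isPreconnected_Ici.intermediate_value (mem_Ici.2 ht)
    (self_mem_Ici (a := (0 : ℝ))) hf ⟨h, h0.le⟩
  exact hne x hx hx0

theorem deriv_pos_of_ne_zero_of_pos {g : ℝ → ℝ} (hg : Differentiable ℝ g) (hg0 : g 0 = 0)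
    (hpos : ∀ t, 0 < t → 0 < g t) (hne : ∀ t, 0 < t → deriv g t ≠ 0) :
    ∀ t, 0 < t → 0 < deriv g t := by
  rcases hasDerivWithinAt_forall_lt_or_forall_gt_of_forall_ne (convex_Ioi (0 : ℝ))
    (fun t _ => (hg t).hasDerivAt.hasDerivWithinAt) hne with h | h
  · have hanti : StrictAntiOn g (Ici 0) :=
      strictAntiOn_of_deriv_neg (convex_Ici 0) hg.continuous.continuousOn (by simpa using h)
    have := hanti self_mem_Ici (mem_Ici.2 zero_le_one) zero_lt_one
    exact absurd (hpos 1 zero_lt_one) (by linarith)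
  · exact h

/-- Global solvability of the implicit differential equation (9) on `[0, ∞)` (the
analytic content of Theorem 1): if the implicit surface `F⁻¹(0)` is regular for `t ≥ 0`
and the fold set is a regular curve, then equation (9) has a solution `w`, smooth on
`[0, ∞)`, with `w(0) = w'(0) = 0` and `w'(t)·φ(0) > 0` for all `t > 0`. -/
theorem stmt_12 (n : ℕ) (hn : 3 ≤ n) (φ ψ : ℝ → ℝ)
    (hφ : ContDiff ℝ (⊤ : ℕ∞) φ) (hψ : ContDiff ℝ (⊤ : ℕ∞) ψ)
    (h0 : φ 0 = ψ 0) (hne : φ 0 ≠ 0)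
    (hpos : ∀ t : ℝ, 0 ≤ t → 0 < φ t * ψ t)
    (F : ℝ → ℝ → ℝ → ℝ)
    (hF : ∀ t w p : ℝ, F t w p =
      (1 / ((n : ℝ) - 1)) * (((n : ℝ) - 2) * φ t * (w ^ 2 - 2 * w) + t ^ 2 * φ t * ψ t)
        - p ^ 2)
    (hreg : ∀ t w p : ℝ, 0 ≤ t → F t w p = 0 →
      (deriv (fun s => F s w p) t, deriv (fun x => F t x p) w,
        deriv (fun q => F t w q) p) ≠ (0, 0, 0))
    (hfold : ∀ t : ℝ, 0 < t → deriv (fun s => s ^ 2 * ψ s) t * φ t ≠ 0) :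
    ∃ w : ℝ → ℝ,
      ContDiffOn ℝ (⊤ : ℕ∞) w (Set.Ici 0) ∧
      w 0 = 0 ∧
      derivWithin w (Set.Ici 0) 0 = 0 ∧
      (∀ t : ℝ, 0 ≤ t →
        (derivWithin w (Set.Ici 0) t) ^ 2 =
          (1 / ((n : ℝ) - 1)) *
            (((n : ℝ) - 2) * φ t * ((w t) ^ 2 - 2 * w t) + t ^ 2 * φ t * ψ t)) ∧
      ∀ t : ℝ, 0 < t → 0 < derivWithin w (Set.Ici 0) t * φ 0 := by
  obtain ⟨k, rfl⟩ := Nat.exists_eq_add_of_le' hn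
  have hφne : ∀ t, 0 ≤ t → φ t ≠ 0 := fun t ht h => by simpa [h] using hpos t ht
  obtain ⟨σ, hσ, hσφ0⟩ : ∃ σ : ℝ, σ * σ = 1 ∧ 0 < σ * φ 0 := by
    rcases hne.lt_or_gt with h | h
    · exact ⟨-1, by norm_num, by linarith⟩
    · exact ⟨1, by norm_num, by linarith⟩
  have hσne : σ ≠ 0 := left_ne_zero_of_mul_eq_one hσ
  have hσφ : ∀ t, 0 ≤ t → 0 < σ * φ t := fun t ht =>
    pos_of_continuousOn_Ici_of_ne_zero (f := fun t => σ * φ t)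
      (continuous_const.mul hφ.continuous).continuousOn
      (fun t ht => mul_ne_zero hσne (hφne t ht)) hσφ0 ht
  have hσψ : ∀ t, 0 ≤ t → 0 < σ * ψ t := fun t ht => by
    refine pos_of_mul_pos_right (a := σ * φ t) ?_ (hσφ t ht).le
    have : σ * φ t * (σ * ψ t) = φ t * ψ t := by linear_combination φ t * ψ t * hσ
    exact this ▸ hpos t ht
  have hg : ContDiff ℝ (⊤ : ℕ∞) (fun s => s ^ 2 * ψ s) := by fun_prop
  have hsmul : (fun s => s ^ 2 * (σ * ψ s)) = fun s => σ * (s ^ 2 * ψ s) := by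
    ext s; ring
  have hderiv : ∀ t, 0 < t → 0 < deriv (fun s => s ^ 2 * (σ * ψ s)) t := by
    refine deriv_pos_of_ne_zero_of_pos ?_ (by simp)
      (fun t ht => mul_pos (by positivity) (hσψ t ht.le)) fun t ht => ?_
    · rw [hsmul]
      exact (hg.differentiable (by simp)).const_mul σ
    · rw [hsmul, deriv_const_mul _ (hg.differentiable (by simp) t)]
      exact mul_ne_zero hσne (left_ne_zero_of_mul (hfold t ht))
  obtain ⟨y, hys, hy0, hyd0, hyd⟩ := exists_smooth_solution k
    (f := fun t => 1 / ((k : ℝ) + 2) * (σ * φ t)) (ψ := fun t => σ * ψ t) (σ := σ)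
    (m := (k : ℝ) + 1) (a := 1 / ((k : ℝ) + 2) * (σ * φ 0) / 2)
    (contDiff_const.mul (contDiff_const.mul hφ)) (contDiff_const.mul hψ) (by positivity) rfl
    (by ring) (by rw [← h0]; field_simp; ring)
    (by rw [← sq_le_one_iff_abs_le_one, sq, hσ])
    (fun t ht => mul_pos (by positivity) (hσφ t ht)) hderiv
  have hw0 : derivWithin (fun t => σ * y t) (Ici 0) 0 = 0 := by
    have h := hyd0.const_mul σ
    rw [mul_zero] at h
    exact h.derivWithin (uniqueDiffOn_Ici 0 0 self_mem_Ici)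
  have hw := fun (t : ℝ) (ht : 0 < t) => (((hyd t ht).2.const_mul σ).hasDerivWithinAt).derivWithin
    (uniqueDiffOn_Ici 0 t ht.le)
  refine ⟨fun t => σ * y t, contDiffOn_const.mul hys, by simp [hy0], hw0, fun t ht => ?_,
    fun t ht => ?_⟩
  · push_cast
    rcases ht.eq_or_lt with rfl | ht
    · rw [hw0, hy0]
      ring
    · rw [hw t ht, mul_pow, Real.sq_sqrt (hyd t ht).1.le, sq, hσ, one_mul, radicand]
      have h1 : (k : ℝ) + 3 - 1 = k + 2 := by ring
      rw [h1]
      linear_combination 1 / ((k : ℝ) + 2) * t ^ 2 * φ t * ψ t * hσ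
  · rw [hw t ht]
    calc (0 : ℝ) < √_ * (σ * φ 0) := mul_pos (Real.sqrt_pos.2 (hyd t ht).1) hσφ0
      _ = _ := by ring
end
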